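/- Let X be a Banach space and Γ : [0,1] → cwk(X) a scalarly Henstock–Kurzweil integrable multifunction. The following are equivalent: (i) Γ is Henstock integrable; (ii) Γ has at least one Henstock integrable selection and for every Henstock integrable selection f of Γ the multifunction t ↦ Γ(t) − f(t) is McShane integrable; (iii) there exists a Henstock integrable selection f of Γ such that t ↦ Γ(t) − f(t) is McShane integrable. -/

import Mathlib

open Set Metric MeasureTheory Pointwise
open scoped ENNReal NNReal

namespace GaugePaper

variable (X : Type*) [NormedAddCommGroup X] [NormedSpace ℝ X]

/-- `A ∈ cwk(X)`: `A` is a nonempty, convex and weakly compact subset of `X`. -/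
def IsCWK (A : Set X) : Prop :=
  A.Nonempty ∧ Convex ℝ A ∧ IsCompact (toWeakSpace ℝ X '' A)

variable {X}

/-- The support function `σ(x*, A)`. -/
noncomputable def suppFn (x' : X →L[ℝ] ℝ) (A : Set X) : ℝ := sSup (x' '' A)

/-- `‖A‖ = sup {‖x‖ : x ∈ A}`. -/
noncomputable def setNorm (A : Set X) : ℝ := sSup ((fun x => ‖x‖) '' A)

/-- A gauge on `[0,1]`: a positive function. -/
def IsGauge (δ : ℝ → ℝ) : Prop := ∀ t ∈ Icc (0:ℝ) 1, 0 < δ t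

/-- A tagged partition of `[0,1]` into `n` (possibly degenerate) nonoverlapping closed
subintervals `[pt i, pt (i+1)]`, with tags `tag i ∈ [0,1]`. -/
structure TP (n : ℕ) where
  pt : Fin (n + 1) → ℝ
  tag : Fin n → ℝ
  mono : Monotone pt
  first : pt 0 = 0
  last : pt (Fin.last n) = 1
  tagMem : ∀ i, tag i ∈ Icc (0:ℝ) 1

namespace TP

variable {n : ℕ} (P : TP n)

/-- The `i`-th subinterval of the partition. -/
def ivl (i : Fin n) : Set ℝ := Icc (P.pt i.castSucc) (P.pt i.succ)

/-- The length `|I_i|` of the `i`-th subinterval. -/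
def len (i : Fin n) : ℝ := P.pt i.succ - P.pt i.castSucc

/-- A Perron (Henstock) partition: each tag belongs to its interval. -/
def IsPerron : Prop := ∀ i, P.tag i ∈ P.ivl i

/-- `δ`-fineness: `I_i ⊆ (t_i - δ(t_i), t_i + δ(t_i))`. -/
def IsFine (δ : ℝ → ℝ) : Prop :=
  ∀ i, P.ivl i ⊆ Ioo (P.tag i - δ (P.tag i)) (P.tag i + δ (P.tag i))

/-- An interior Henstock partition: each tag is in the interior of its interval, except
possibly for intervals containing `0` or `1`, where the tag may also be `0` or `1`. -/
def IsInterior : Prop :=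
  ∀ i, P.tag i ∈ Ioo (P.pt i.castSucc) (P.pt i.succ) ∨
    (((0:ℝ) ∈ P.ivl i ∨ (1:ℝ) ∈ P.ivl i) ∧ P.tag i ∈ P.ivl i ∩ ({0, 1} : Set ℝ))

end TP

/-- Riemann sum of a multifunction: `∑ i |I_i| • Γ(t_i)` (Minkowski sums). -/
def mSum {n : ℕ} (P : TP n) (Γ : ℝ → Set X) : Set X :=
  ∑ i : Fin n, P.len i • Γ (P.tag i)

/-- Riemann sum of a function: `∑ i |I_i| • f(t_i)`. -/
def fSum {n : ℕ} (P : TP n) (f : ℝ → X) : X :=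
  ∑ i : Fin n, P.len i • f (P.tag i)

/-! ### Gauge integrals of multifunctions -/

/-- Henstock integrability of a multifunction `Γ : [0,1] → cwk(X)`. -/
def HenstockIntegrable (Γ : ℝ → Set X) : Prop :=
  ∃ I : Set X, IsCWK X I ∧ ∀ ε > 0, ∃ δ : ℝ → ℝ, IsGauge δ ∧
    ∀ (n : ℕ) (P : TP n), P.IsPerron → P.IsFine δ → hausdorffDist I (mSum P Γ) < ε

/-- McShane integrability of a multifunction (free tags). -/
def McShaneIntegrable (Γ : ℝ → Set X) : Prop :=
  ∃ I : Set X, IsCWK X I ∧ ∀ ε > 0, ∃ δ : ℝ → ℝ, IsGauge δ ∧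
    ∀ (n : ℕ) (P : TP n), P.IsFine δ → hausdorffDist I (mSum P Γ) < ε

/-- `ℋ`-integrability: Henstock integrability with Lebesgue measurable gauges. -/
def HMeasIntegrable (Γ : ℝ → Set X) : Prop :=
  ∃ I : Set X, IsCWK X I ∧ ∀ ε > 0, ∃ δ : ℝ → ℝ, IsGauge δ ∧ AEMeasurable δ volume ∧
    ∀ (n : ℕ) (P : TP n), P.IsPerron → P.IsFine δ → hausdorffDist I (mSum P Γ) < ε

/-- Birkhoff (`ℳ`-) integrability: McShane integrability with Lebesgue measurable gauges. -/
def BirkhoffIntegrable (Γ : ℝ → Set X) : Prop :=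
  ∃ I : Set X, IsCWK X I ∧ ∀ ε > 0, ∃ δ : ℝ → ℝ, IsGauge δ ∧ AEMeasurable δ volume ∧
    ∀ (n : ℕ) (P : TP n), P.IsFine δ → hausdorffDist I (mSum P Γ) < ε

/-! ### Gauge integrals of (single-valued) functions -/

/-- Henstock integrability of a function `f : [0,1] → X`. -/
def FHenstockIntegrable (f : ℝ → X) : Prop :=
  ∃ w : X, ∀ ε > 0, ∃ δ : ℝ → ℝ, IsGauge δ ∧
    ∀ (n : ℕ) (P : TP n), P.IsPerron → P.IsFine δ → ‖w - fSum P f‖ < ε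

/-- McShane integrability of a function. -/
def FMcShaneIntegrable (f : ℝ → X) : Prop :=
  ∃ w : X, ∀ ε > 0, ∃ δ : ℝ → ℝ, IsGauge δ ∧
    ∀ (n : ℕ) (P : TP n), P.IsFine δ → ‖w - fSum P f‖ < ε

/-- `ℋ`-integrability of a function: measurable gauges. -/
def FHMeasIntegrable (f : ℝ → X) : Prop :=
  ∃ w : X, ∀ ε > 0, ∃ δ : ℝ → ℝ, IsGauge δ ∧ AEMeasurable δ volume ∧
    ∀ (n : ℕ) (P : TP n), P.IsPerron → P.IsFine δ → ‖w - fSum P f‖ < ε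

/-- Birkhoff (`ℳ`-) integrability of a function: McShane with measurable gauges. -/
def FBirkhoffIntegrable (f : ℝ → X) : Prop :=
  ∃ w : X, ∀ ε > 0, ∃ δ : ℝ → ℝ, IsGauge δ ∧ AEMeasurable δ volume ∧
    ∀ (n : ℕ) (P : TP n), P.IsFine δ → ‖w - fSum P f‖ < ε

/-- Henstock–Kurzweil integrability of a real-valued function on `[0,1]`. -/
def HKIntegrable (g : ℝ → ℝ) : Prop :=
  ∃ A : ℝ, ∀ ε > 0, ∃ δ : ℝ → ℝ, IsGauge δ ∧
    ∀ (n : ℕ) (P : TP n), P.IsPerron → P.IsFine δ → |fSum P g - A| < ε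

/-! ### Pettis integrals -/

/-- Pettis integrability of a function `f : [0,1] → X`. -/
def FPettisIntegrable (f : ℝ → X) : Prop :=
  (∀ x' : X →L[ℝ] ℝ, IntegrableOn (fun t => x' (f t)) (Icc (0:ℝ) 1) volume) ∧
  ∀ E ⊆ Icc (0:ℝ) 1, NullMeasurableSet E volume →
    ∃ ν : X, ∀ x' : X →L[ℝ] ℝ, x' ν = ∫ t in E, x' (f t)

/-- Pettis integrability of a multifunction `Γ : [0,1] → cwk(X)`. -/
def PettisIntegrable (Γ : ℝ → Set X) : Prop :=
  (∀ x' : X →L[ℝ] ℝ, IntegrableOn (fun t => suppFn x' (Γ t)) (Icc (0:ℝ) 1) volume) ∧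
  ∀ E ⊆ Icc (0:ℝ) 1, NullMeasurableSet E volume →
    ∃ W : Set X, IsCWK X W ∧ ∀ x' : X →L[ℝ] ℝ, suppFn x' W = ∫ t in E, suppFn x' (Γ t)

/-- `f` is a selection of `Γ`. -/
def Selection (Γ : ℝ → Set X) (f : ℝ → X) : Prop := ∀ t ∈ Icc (0:ℝ) 1, f t ∈ Γ t

/-! ### Variational integrals -/

/-- Finite additivity of an interval multifunction on subintervals of `[0,1]`
(an interval `[a,b] ⊆ [0,1]` is encoded by its endpoints). -/
def AdditiveIntervalMF (Φ : ℝ → ℝ → Set X) : Prop :=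
  ∀ a b c : ℝ, 0 ≤ a → a ≤ b → b ≤ c → c ≤ 1 → Φ a c = Φ a b + Φ b c

/-- Finite additivity of a vector-valued interval function on subintervals of `[0,1]`. -/
def AdditiveIntervalF (Φ : ℝ → ℝ → X) : Prop :=
  ∀ a b c : ℝ, 0 ≤ a → a ≤ b → b ≤ c → c ≤ 1 → Φ a c = Φ a b + Φ b c

/-- `Φ` is a variational Henstock primitive of the multifunction `Γ`. -/
def vHPrimitive (Γ : ℝ → Set X) (Φ : ℝ → ℝ → Set X) : Prop :=
  (∀ a b : ℝ, 0 ≤ a → a ≤ b → b ≤ 1 → IsCWK X (Φ a b)) ∧ AdditiveIntervalMF Φ ∧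
  ∀ ε > 0, ∃ δ : ℝ → ℝ, IsGauge δ ∧ ∀ (n : ℕ) (P : TP n), P.IsPerron → P.IsFine δ →
    ∑ i : Fin n, hausdorffDist (Φ (P.pt i.castSucc) (P.pt i.succ)) (P.len i • Γ (P.tag i)) < ε

/-- Variational Henstock integrability of a multifunction. -/
def vHIntegrable (Γ : ℝ → Set X) : Prop := ∃ Φ : ℝ → ℝ → Set X, vHPrimitive Γ Φ

/-- Variational McShane integrability of a multifunction (free tags). -/
def vMSIntegrable (Γ : ℝ → Set X) : Prop :=
  ∃ Φ : ℝ → ℝ → Set X,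
    (∀ a b : ℝ, 0 ≤ a → a ≤ b → b ≤ 1 → IsCWK X (Φ a b)) ∧ AdditiveIntervalMF Φ ∧
    ∀ ε > 0, ∃ δ : ℝ → ℝ, IsGauge δ ∧ ∀ (n : ℕ) (P : TP n), P.IsFine δ →
      ∑ i : Fin n, hausdorffDist (Φ (P.pt i.castSucc) (P.pt i.succ)) (P.len i • Γ (P.tag i)) < ε

/-- Variational `ℋ`-integrability of a multifunction: measurable gauges. -/
def vHMeasIntegrable (Γ : ℝ → Set X) : Prop :=
  ∃ Φ : ℝ → ℝ → Set X,
    (∀ a b : ℝ, 0 ≤ a → a ≤ b → b ≤ 1 → IsCWK X (Φ a b)) ∧ AdditiveIntervalMF Φ ∧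
    ∀ ε > 0, ∃ δ : ℝ → ℝ, IsGauge δ ∧ AEMeasurable δ volume ∧
      ∀ (n : ℕ) (P : TP n), P.IsPerron → P.IsFine δ →
        ∑ i : Fin n, hausdorffDist (Φ (P.pt i.castSucc) (P.pt i.succ)) (P.len i • Γ (P.tag i)) < ε

/-- `Φ` is a variational Henstock primitive of the function `f`. -/
def FvHPrimitive (f : ℝ → X) (Φ : ℝ → ℝ → X) : Prop :=
  AdditiveIntervalF Φ ∧
  ∀ ε > 0, ∃ δ : ℝ → ℝ, IsGauge δ ∧ ∀ (n : ℕ) (P : TP n), P.IsPerron → P.IsFine δ →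
    ∑ i : Fin n, ‖Φ (P.pt i.castSucc) (P.pt i.succ) - P.len i • f (P.tag i)‖ < ε

/-- Variational Henstock integrability of a function. -/
def FvHIntegrable (f : ℝ → X) : Prop := ∃ Φ : ℝ → ℝ → X, FvHPrimitive f Φ

/-- Variational McShane integrability of a function (free tags). -/
def FvMSIntegrable (f : ℝ → X) : Prop :=
  ∃ Φ : ℝ → ℝ → X, AdditiveIntervalF Φ ∧
    ∀ ε > 0, ∃ δ : ℝ → ℝ, IsGauge δ ∧ ∀ (n : ℕ) (P : TP n), P.IsFine δ →
      ∑ i : Fin n, ‖Φ (P.pt i.castSucc) (P.pt i.succ) - P.len i • f (P.tag i)‖ < ε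

/-- Variational `ℋ`-integrability of a function: measurable gauges. -/
def FvHMeasIntegrable (f : ℝ → X) : Prop :=
  ∃ Φ : ℝ → ℝ → X, AdditiveIntervalF Φ ∧
    ∀ ε > 0, ∃ δ : ℝ → ℝ, IsGauge δ ∧ AEMeasurable δ volume ∧
      ∀ (n : ℕ) (P : TP n), P.IsPerron → P.IsFine δ →
        ∑ i : Fin n, ‖Φ (P.pt i.castSucc) (P.pt i.succ) - P.len i • f (P.tag i)‖ < ε

/-! ### Partial Perron partitions and variational measures -/

/-- A finite tagged Perron family of `n` nonoverlapping closed subintervals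
`[a i, b i]` of `[0,1]` (a "partition in `[0,1]`", not necessarily covering it). -/
structure PTP (n : ℕ) where
  a : Fin n → ℝ
  b : Fin n → ℝ
  tag : Fin n → ℝ
  le : ∀ i, a i ≤ b i
  sub : ∀ i, Icc (a i) (b i) ⊆ Icc (0:ℝ) 1
  nonoverlap : ∀ i j, i ≠ j → (Icc (a i) (b i) ∩ Icc (a j) (b j)).Subsingleton
  perron : ∀ i, tag i ∈ Icc (a i) (b i)

/-- `δ`-fineness of a partial Perron family. -/
def PTP.IsFine {n : ℕ} (P : PTP n) (δ : ℝ → ℝ) : Prop :=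
  ∀ i, Icc (P.a i) (P.b i) ⊆ Ioo (P.tag i - δ (P.tag i)) (P.tag i + δ (P.tag i))

/-- `Var(Ψ, δ, E)` for a scalar interval function `Ψ`. -/
noncomputable def scVar (Ψ : ℝ → ℝ → ℝ) (δ : ℝ → ℝ) (E : Set ℝ) : ℝ≥0∞ :=
  ⨆ (n : ℕ) (P : PTP n) (_ : P.IsFine δ ∧ ∀ i, P.tag i ∈ E),
    ∑ i : Fin n, ENNReal.ofReal |Ψ (P.a i) (P.b i)|

/-- The variational measure `V_Ψ(E)` generated by a scalar interval function `Ψ`. -/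
noncomputable def scVarMeasure (Ψ : ℝ → ℝ → ℝ) (E : Set ℝ) : ℝ≥0∞ :=
  ⨅ (δ : ℝ → ℝ) (_ : IsGauge δ), scVar Ψ δ E

/-- `HS δ g u v s`: some `δ`-fine Perron partition of `[u, v]` has Riemann sum `s` for `g`. -/
inductive HS (δ g : ℝ → ℝ) : ℝ → ℝ → ℝ → Prop
  | nil (u : ℝ) : HS δ g u u 0
  | cons {u t v w s : ℝ} (hut : u ≤ t) (htv : t ≤ v) (hu : t - δ t < u) (hv : v < t + δ t)
      (h : HS δ g v w s) : HS δ g u w ((v - u) * g t + s)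

namespace HS

variable {δ g : ℝ → ℝ} {u v w s s' : ℝ}

lemma le (h : HS δ g u v s) : u ≤ v := by
  induction h with
  | nil => exact le_rfl
  | cons h1 h2 _ _ _ ih => linarith

lemma append (h : HS δ g u v s) (h' : HS δ g v w s') : HS δ g u w (s + s') := by
  induction h with
  | nil => simpa using h'
  | cons h1 h2 h3 h4 _ ih =>
    rw [add_assoc]
    exact .cons h1 h2 h3 h4 (ih h')

lemma single {t : ℝ} (hut : u ≤ t) (htv : t ≤ v) (hu : t - δ t < u) (hv : v < t + δ t) :
    HS δ g u v ((v - u) * g t) := by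
  simpa using HS.cons (g := g) hut htv hu hv (.nil v)

/-- Cousin's lemma. -/
lemma exists_of_le (hδ : ∀ t ∈ Icc u v, 0 < δ t) (huv : u ≤ v) : ∃ s, HS δ g u v s := by
  set S : Set ℝ := {x | x ∈ Icc u v ∧ ∃ s, HS δ g u x s} with hS
  have huS : u ∈ S := ⟨⟨le_rfl, huv⟩, 0, .nil u⟩
  have hbdd : BddAbove S := ⟨v, fun x hx => hx.1.2⟩
  set c := sSup S with hc
  have huc : u ≤ c := le_csSup hbdd huS
  have hcv : c ≤ v := csSup_le ⟨u, huS⟩ fun x hx => hx.1.2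
  have hδc := hδ c ⟨huc, hcv⟩
  obtain ⟨x, hxS, hx⟩ := exists_lt_of_lt_csSup ⟨u, huS⟩ (show c - δ c < sSup S by linarith)
  have hxc : x ≤ c := le_csSup hbdd hxS
  obtain ⟨s, hs⟩ := hxS.2
  have key : ∀ y, c ≤ y → y < c + δ c → ∃ s, HS δ g u y s := fun y hy hy' =>
    ⟨_, hs.append (.single hxc hy hx hy')⟩
  rcases hcv.eq_or_lt with h | h
  · rw [← h]
    exact key c le_rfl (by linarith)
  · exfalso
    have h1 : min v (c + δ c / 2) ∈ S :=
      ⟨⟨le_min huv (by linarith), min_le_left _ _⟩,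
        key _ (le_min hcv (by linarith)) ((min_le_right _ _).trans_lt (by linarith))⟩
    have h2 := le_csSup hbdd h1
    have h3 : c < min v (c + δ c / 2) := lt_min h (by linarith)
    exact absurd h2 (not_le.2 h3)

lemma exists_points (h : HS δ g u v s) : ∃ (n : ℕ) (pt : Fin (n + 1) → ℝ) (tag : Fin n → ℝ),
    Monotone pt ∧ pt 0 = u ∧ pt (Fin.last n) = v ∧
    (∀ i, pt i.castSucc ≤ tag i ∧ tag i ≤ pt i.succ ∧ tag i - δ (tag i) < pt i.castSucc ∧
      pt i.succ < tag i + δ (tag i)) ∧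
    s = ∑ i, (pt i.succ - pt i.castSucc) * g (tag i) := by
  induction h with
  | nil u => exact ⟨0, fun _ => u, Fin.elim0, monotone_const, rfl, rfl, fun i => i.elim0, by simp⟩
  | @cons u t v w s h1 h2 h3 h4 _ ih =>
    obtain ⟨n, pt, tag, hm, h0, hl, hf, hs⟩ := ih
    refine ⟨n + 1, Fin.cons u pt, Fin.cons t tag, ?_, rfl, ?_, ?_, ?_⟩
    · rw [Fin.monotone_iff_le_succ]
      intro i
      refine Fin.cases ?_ (fun j => ?_) i
      · simp [h0]
        linarith
      · rw [← Fin.succ_castSucc]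
        simpa using hm (Fin.castSucc_lt_succ (i := j)).le
    · rw [← Fin.succ_last]
      simpa using hl
    · intro i
      refine Fin.cases ?_ (fun j => ?_) i
      · simp [h0]
        exact ⟨h1, h2, by linarith, h4⟩
      · rw [← Fin.succ_castSucc]
        simpa using hf j
    · rw [Fin.sum_univ_succ, hs]
      simp [h0]

lemma exists_TP (h : HS δ g 0 1 s) : ∃ (n : ℕ) (P : TP n), P.IsPerron ∧ P.IsFine δ ∧
    fSum P g = s := by
  obtain ⟨n, pt, tag, hm, h0, hl, hf, hs⟩ := h.exists_points
  refine ⟨n, ⟨pt, tag, hm, h0, hl, fun i => ⟨?_, ?_⟩⟩, fun i => ⟨(hf i).1, (hf i).2.1⟩,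
    fun i x hx => ⟨(hf i).2.2.1.trans_le hx.1, hx.2.trans_lt (hf i).2.2.2⟩, ?_⟩
  · rw [← h0]
    exact (hm (Fin.zero_le _)).trans (hf i).1
  · rw [← hl]
    exact (hf i).2.1.trans (hm (Fin.le_last _))
  · simp [fSum, hs, TP.len]

/-- Completing a finite disjoint family of tagged intervals to a partition, for two choices of
tags simultaneously. -/
lemma exists_complete {ι : Type*} (S : Finset ι) {a b t t' : ι → ℝ} {u : ℝ}
    (hab : ∀ i ∈ S, a i ≤ b i) (hu : ∀ i ∈ S, u ≤ a i)
    (hd : (S : Set ι).PairwiseDisjoint fun i => Icc (a i) (b i))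
    (ht : ∀ i ∈ S, t i ∈ Icc (a i) (b i) ∧ t i - δ (t i) < a i ∧ b i < t i + δ (t i))
    (ht' : ∀ i ∈ S, t' i ∈ Icc (a i) (b i) ∧ t' i - δ (t' i) < a i ∧ b i < t' i + δ (t' i)) :
    ∀ v, u ≤ v → (∀ i ∈ S, b i ≤ v) → (∀ x ∈ Icc u v, 0 < δ x) →
      ∃ s, HS δ g u v (s + ∑ i ∈ S, (b i - a i) * g (t i)) ∧
        HS δ g u v (s + ∑ i ∈ S, (b i - a i) * g (t' i)) := by
  classical
  induction S using Finset.induction_on_max_value a with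
  | empty =>
    intro v huv _ hδ
    obtain ⟨s, hs⟩ := exists_of_le (g := g) hδ huv
    exact ⟨s, by simpa using hs, by simpa using hs⟩
  | insert i S hi hmax ih =>
    intro v huv hbv hδ
    have hiS := Finset.mem_insert_self i S
    have hsub : ∀ j ∈ S, j ∈ insert i S := fun j hj => Finset.mem_insert_of_mem hj
    have hbi := hbv i hiS
    have hui := hu i hiS
    have habi := hab i hiS
    obtain ⟨s, h1, h2⟩ := ih (fun j hj => hab j (hsub j hj)) (fun j hj => hu j (hsub j hj))
      (hd.subset (by simp)) (fun j hj => ht j (hsub j hj)) (fun j hj => ht' j (hsub j hj))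
      (a i) hui (fun j hj => by
        by_contra hlt
        have hne : j ≠ i := fun h => hi (h ▸ hj)
        exact Set.disjoint_left.1 (hd (hsub j hj) hiS hne) ⟨hmax j hj, (not_le.1 hlt).le⟩
          ⟨le_rfl, habi⟩)
      (fun x hx => hδ x ⟨hx.1, hx.2.trans (habi.trans hbi)⟩)
    obtain ⟨s', hs'⟩ := exists_of_le (g := g)
      (fun x hx => hδ x ⟨(hui.trans habi).trans hx.1, hx.2⟩) hbi
    obtain ⟨⟨p1, p2⟩, p3, p4⟩ := ht i hiS
    obtain ⟨⟨q1, q2⟩, q3, q4⟩ := ht' i hiS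
    refine ⟨s + s', ?_, ?_⟩
    · rw [Finset.sum_insert hi]
      convert (h1.append (.single p1 p2 p3 p4)).append hs' using 1
      ring
    · rw [Finset.sum_insert hi]
      convert (h2.append (.single q1 q2 q3 q4)).append hs' using 1
      ring

/-- The step function attached to a tagged partition. -/
lemma exists_step (h : HS δ g u v s) : ∃ φ : ℝ → ℝ, Measurable φ ∧
    (∀ x, u < x → x ≤ v → ∃ a b t, u ≤ a ∧ a ≤ x ∧ x ≤ b ∧ b ≤ v ∧ a ≤ t ∧ t ≤ b ∧
      t - δ t < a ∧ b < t + δ t ∧ φ x = g t) ∧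
    ((∀ t ∈ Icc u v, 0 ≤ g t) → 0 ≤ s ∧ ∫⁻ x in Ioc u v, ENNReal.ofReal (φ x) = ENNReal.ofReal s) := by
  induction h with
  | nil u => exact ⟨0, measurable_const, fun x h1 h2 => absurd h1 (not_lt.2 h2), by simp⟩
  | @cons u t v w s h1 h2 h3 h4 hh ih =>
    obtain ⟨φ, hφm, hφ, hφi⟩ := ih
    have hvw := hh.le
    refine ⟨fun x => if x ≤ v then g t else φ x,
      Measurable.ite measurableSet_Iic measurable_const hφm, fun x hx1 hx2 => ?_, fun hg => ?_⟩
    · by_cases hxv : x ≤ v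
      · exact ⟨u, v, t, le_rfl, hx1.le, hxv, hvw, h1, h2, h3, h4, by simp [hxv]⟩
      · obtain ⟨a, b, t', q1, q⟩ := hφ x (not_le.1 hxv) hx2
        exact ⟨a, b, t', by linarith, by simpa [hxv] using q⟩
    · obtain ⟨hs, hi⟩ := hφi fun t' ht' => hg t' ⟨by linarith [ht'.1], ht'.2⟩
      have hgt : 0 ≤ g t := hg t ⟨h1, by linarith⟩
      have hvu : 0 ≤ v - u := by linarith
      refine ⟨by positivity, ?_⟩
      rw [← Ioc_union_Ioc_eq_Ioc (show u ≤ v by linarith) hvw,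
        lintegral_union measurableSet_Ioc (by
          rw [Set.disjoint_left]; rintro x hx hx'; exact absurd hx.2 (not_le.2 hx'.1)),
        ENNReal.ofReal_add (by positivity) hs, ← hi]
      congr 1
      · rw [setLIntegral_congr_fun (g := fun _ => ENNReal.ofReal (g t)) measurableSet_Ioc
          (fun x hx => by simp [hx.2])]
        rw [setLIntegral_const, Real.volume_Ioc, ENNReal.ofReal_mul hvu, mul_comm]
      · exact setLIntegral_congr_fun measurableSet_Ioc (fun x hx => by simp [not_le.2 hx.1])

end HS

/-- `δ` is a gauge witnessing that Perron Riemann sums of `g` are within `ε` of `I`. -/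
def GaugeFor (δ g : ℝ → ℝ) (I ε : ℝ) : Prop :=
  IsGauge δ ∧ ∀ (n : ℕ) (P : TP n), P.IsPerron → P.IsFine δ → |fSum P g - I| ≤ ε

/-- Two tags `t, t'` for a common interval `[a, b]`, with values of `g` more than `c` apart. -/
def BadPair (δ g : ℝ → ℝ) (c a b : ℝ) : Prop :=
  0 ≤ a ∧ b ≤ 1 ∧ ∃ t t', (t ∈ Icc a b ∧ t - δ t < a ∧ b < t + δ t) ∧
    (t' ∈ Icc a b ∧ t' - δ t' < a ∧ b < t' + δ t') ∧ c < g t - g t'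

lemma GaugeFor.sum_badPair_le {δ g : ℝ → ℝ} {I ε c : ℝ} (h : GaugeFor δ g I ε)
    {ι : Type*} (S : Finset ι) {a b : ι → ℝ}
    (hd : (S : Set ι).PairwiseDisjoint fun i => Icc (a i) (b i))
    (hS : ∀ i ∈ S, BadPair δ g c (a i) (b i)) : c * ∑ i ∈ S, (b i - a i) ≤ 2 * ε := by
  classical
  choose! h0 h1 t t' ht ht' hc using hS
  have hab : ∀ i ∈ S, a i ≤ b i := fun i hi => (ht i hi).1.1.trans (ht i hi).1.2
  obtain ⟨s, hs, hs'⟩ := HS.exists_complete (g := g) S hab h0 hd ht ht' 1 zero_le_one h1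
    (fun x hx => h.1 x hx)
  obtain ⟨n, P, hP, hPf, e1⟩ := hs.exists_TP
  obtain ⟨n', P', hP', hPf', e2⟩ := hs'.exists_TP
  have k1 := abs_le.1 (h.2 n P hP hPf)
  have k2 := abs_le.1 (h.2 n' P' hP' hPf')
  have k3 : c * ∑ i ∈ S, (b i - a i) ≤
      ∑ i ∈ S, (b i - a i) * g (t i) - ∑ i ∈ S, (b i - a i) * g (t' i) := by
    rw [Finset.mul_sum, ← Finset.sum_sub_distrib]
    refine Finset.sum_le_sum fun i hi => ?_
    have := hc i hi
    have := hab i hi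
    nlinarith
  linarith [k1.1, k1.2, k2.1, k2.2]

lemma GaugeFor.volume_badPair_le {δ g : ℝ → ℝ} {I ε c : ℝ} (h : GaugeFor δ g I ε) (hc : 0 < c) :
    volume (⋃ p ∈ {p : ℝ × ℝ | BadPair δ g c p.1 p.2}, Icc p.1 p.2) ≤
      ENNReal.ofReal (8 * ε / c) := by
  set T : Set (ℝ × ℝ) := {p : ℝ × ℝ | BadPair δ g c p.1 p.2} with hT
  have hlt : ∀ p ∈ T, p.1 < p.2 := by
    rintro ⟨a, b⟩ ⟨_, _, t, t', h1, h2, h3⟩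
    refine lt_of_le_of_ne (h1.1.1.trans h1.1.2) fun hab => ?_
    simp only at hab h1 h2
    have e1 : t = a := le_antisymm (hab ▸ h1.1.2) h1.1.1
    have e2 : t' = a := le_antisymm (hab ▸ h2.1.2) h2.1.1
    rw [e1, e2, sub_self] at h3
    exact absurd h3 (not_lt.2 hc.le)
  have hball : ∀ p : ℝ × ℝ, Icc p.1 p.2 = closedBall ((p.1 + p.2) / 2) ((p.2 - p.1) / 2) := by
    intro p
    rw [Real.closedBall_eq_Icc]
    congr 1 <;> ring
  obtain ⟨U, hUT, hUd, hU⟩ := Vitali.exists_disjoint_subfamily_covering_enlargement_closedBall T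
    (fun p => (p.1 + p.2) / 2) (fun p => (p.2 - p.1) / 2) 1
    (fun p hp => by
      obtain ⟨h0, h1, -⟩ := hp
      linarith) 4 (by norm_num)
  replace hUd : U.PairwiseDisjoint fun p => Icc p.1 p.2 := fun p hp q hq hpq => by
    simpa only [Function.onFun, hball] using hUd hp hq hpq
  have hUc : U.Countable := by
    refine hUd.countable_of_nonempty_interior fun p hp => ?_
    rw [interior_Icc]
    exact nonempty_Ioo.2 (hlt p (hUT hp))
  have hsub : (⋃ p ∈ T, Icc p.1 p.2) ⊆
      ⋃ p ∈ U, closedBall ((p.1 + p.2) / 2) (4 * ((p.2 - p.1) / 2)) := by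
    refine iUnion₂_subset fun p hp => ?_
    obtain ⟨b, hb, hb'⟩ := hU p hp
    rw [hball]
    exact hb'.trans (subset_biUnion_of_mem (u := fun p : ℝ × ℝ =>
      closedBall ((p.1 + p.2) / 2) (4 * ((p.2 - p.1) / 2))) hb)
  refine (measure_mono hsub).trans ((measure_biUnion_le volume hUc _).trans ?_)
  rw [ENNReal.tsum_eq_iSup_sum]
  refine iSup_le fun F => ?_
  have h1 := h.sum_badPair_le (c := c) F (a := fun p : U => (p : ℝ × ℝ).1)
    (b := fun p : U => (p : ℝ × ℝ).2)
    (fun p _ q _ hpq => hUd p.2 q.2 (fun e => hpq (Subtype.ext e))) (fun p _ => hUT p.2)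
  have h2 : ∀ p ∈ F, volume (closedBall (((p : ℝ × ℝ).1 + (p : ℝ × ℝ).2) / 2)
      (4 * (((p : ℝ × ℝ).2 - (p : ℝ × ℝ).1) / 2))) =
      ENNReal.ofReal (4 * ((p : ℝ × ℝ).2 - (p : ℝ × ℝ).1)) := fun p _ => by
    rw [Real.volume_closedBall]
    congr 1
    ring
  rw [Finset.sum_congr rfl h2, ← ENNReal.ofReal_sum_of_nonneg
    (fun p _ => by linarith [hlt p (hUT p.2)]), ← Finset.mul_sum]
  refine ENNReal.ofReal_le_ofReal ?_
  rw [le_div_iff₀ hc]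
  linarith

lemma GaugeFor.mono {δ δ' g : ℝ → ℝ} {I ε : ℝ} (h : GaugeFor δ g I ε) (h' : IsGauge δ')
    (hle : ∀ t ∈ Icc (0:ℝ) 1, δ' t ≤ δ t) : GaugeFor δ' g I ε :=
  ⟨h', fun n P hP hPf => h.2 n P hP fun i => (hPf i).trans
    (Ioo_subset_Ioo (by linarith [hle _ (P.tagMem i)]) (by linarith [hle _ (P.tagMem i)]))⟩

/-- A nonnegative Henstock–Kurzweil integrable function agrees almost everywhere with a measurable
function, whose Lebesgue integral is at most the Henstock–Kurzweil integral. -/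
lemma exists_measurable_of_gaugeFor {g : ℝ → ℝ} {I : ℝ} (hg : ∀ t ∈ Icc (0:ℝ) 1, 0 ≤ g t)
    (h : ∀ ε > 0, ∃ δ, GaugeFor δ g I ε) :
    ∃ g' : ℝ → ℝ, Measurable g' ∧ (∀ x, 0 ≤ g' x) ∧ g =ᵐ[volume.restrict (Ioc 0 1)] g' ∧
      ∫⁻ x in Ioc 0 1, ENNReal.ofReal (g' x) ≤ ENNReal.ofReal I := by
  have hε : ∀ k : ℕ, (0:ℝ) < (1 / 2) ^ k := fun k => by positivity
  choose δ hδ using fun k : ℕ => h ((1 / 2) ^ k) (hε k)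
  set D : ℕ → ℝ → ℝ := fun n t => (Finset.range (n + 1)).inf' Finset.nonempty_range_add_one
    (fun k => min (δ k t) (1 / ((k : ℝ) + 1))) with hD
  have hDle : ∀ n k t, k ≤ n → D n t ≤ min (δ k t) (1 / ((k : ℝ) + 1)) := fun n k t hk =>
    Finset.inf'_le (fun k : ℕ => min (δ k t) (1 / ((k : ℝ) + 1)))
      (Finset.mem_range.2 (Nat.lt_succ_of_le hk))
  have hDpos : ∀ n, IsGauge (D n) := fun n t ht => by
    rw [hD, Finset.lt_inf'_iff]
    exact fun k _ => lt_min ((hδ k).1 t ht) (by positivity)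
  have hDg : ∀ n, GaugeFor (D n) g I ((1 / 2) ^ n) := fun n =>
    (hδ n).mono (hDpos n) fun t _ => (hDle n n t le_rfl).trans (min_le_left _ _)
  choose s hs using fun n => HS.exists_of_le (g := g) (hDpos n) zero_le_one
  choose φ hφm hφ hφi using fun n => (hs n).exists_step
  have hsI : Filter.Tendsto s Filter.atTop (nhds I) := by
    rw [tendsto_iff_dist_tendsto_zero]
    refine squeeze_zero (fun _ => dist_nonneg) (fun n => ?_)
      (tendsto_pow_atTop_nhds_zero_of_lt_one (r := (1 / 2 : ℝ)) (by norm_num) (by norm_num))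
    obtain ⟨m, P, hP, hPf, e⟩ := (hs n).exists_TP
    rw [Real.dist_eq, ← e]
    exact (hDg n).2 m P hP hPf
  have hnull : ∀ c > 0, volume {x | x ∈ Ioc (0:ℝ) 1 ∧ ∃ᶠ n in Filter.atTop,
      c < |φ n x - g x|} = 0 := by
    intro c hc
    have hlim : Filter.Tendsto (fun k : ℕ => ENNReal.ofReal (8 * (1 / 2) ^ k / c)) Filter.atTop
        (nhds 0) := by
      rw [← ENNReal.ofReal_zero]
      refine ENNReal.tendsto_ofReal ?_
      have := ((tendsto_pow_atTop_nhds_zero_of_lt_one (r := (1 / 2 : ℝ)) (by norm_num)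
        (by norm_num)).const_mul 8).div_const c
      simpa using this
    refine le_antisymm (ge_of_tendsto' hlim fun k => ?_) bot_le
    refine (measure_mono ?_).trans ((hδ k).volume_badPair_le hc)
    rintro x ⟨hx, hfreq⟩
    have hx' : x ∈ Icc (0:ℝ) 1 := Ioc_subset_Icc_self hx
    have hev : ∀ᶠ n : ℕ in Filter.atTop, 2 * (1 / ((n : ℝ) + 1)) < δ k x := by
      have : Filter.Tendsto (fun n : ℕ => 2 * (1 / ((n : ℝ) + 1))) Filter.atTop (nhds (2 * 0)) :=
        tendsto_one_div_add_atTop_nhds_zero_nat.const_mul 2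
      rw [mul_zero] at this
      exact this.eventually_lt_const ((hδ k).1 x hx')
    obtain ⟨n, hcn, hn, hkn⟩ := (hfreq.and_eventually
      (hev.and (Filter.eventually_ge_atTop k))).exists
    obtain ⟨a, b, t, h0, h1, h2, h3, h4, h5, h6, h7, h8⟩ := hφ n x hx.1 hx.2
    have e1 : D n t ≤ δ k t := (hDle n k t hkn).trans (min_le_left _ _)
    have e2 : D n t ≤ 1 / ((n : ℝ) + 1) := (hDle n n t le_rfl).trans (min_le_right _ _)
    have ft : t ∈ Icc a b ∧ t - δ k t < a ∧ b < t + δ k t := ⟨⟨h4, h5⟩, by linarith, by linarith⟩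
    have fx : x ∈ Icc a b ∧ x - δ k x < a ∧ b < x + δ k x := ⟨⟨h1, h2⟩, by linarith, by linarith⟩
    rw [mem_iUnion₂]
    refine ⟨(a, b), ⟨h0, h3, ?_⟩, ⟨h1, h2⟩⟩
    rw [h8] at hcn
    rcases lt_abs.1 hcn with hlt | hlt
    · exact ⟨t, x, ft, fx, hlt⟩
    · exact ⟨x, t, fx, ft, by linarith⟩
  have hae : ∀ᵐ x ∂(volume.restrict (Ioc (0:ℝ) 1)),
      Filter.Tendsto (fun n => φ n x) Filter.atTop (nhds (g x)) := by
    have h1 : ∀ᵐ x ∂(volume : Measure ℝ), ∀ j : ℕ, ¬ (x ∈ Ioc (0:ℝ) 1 ∧ ∃ᶠ n in Filter.atTop,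
        1 / ((j : ℝ) + 1) < |φ n x - g x|) := by
      rw [ae_all_iff]
      intro j
      rw [ae_iff]
      simpa only [not_not] using hnull (1 / ((j : ℝ) + 1)) (by positivity)
    rw [ae_restrict_iff' measurableSet_Ioc]
    filter_upwards [h1] with x hx hx1
    rw [Metric.tendsto_nhds]
    intro ε hε
    obtain ⟨j, hj⟩ := exists_nat_one_div_lt hε
    have := hx j
    rw [not_and, Filter.not_frequently] at this
    filter_upwards [this hx1] with n hn
    rw [Real.dist_eq]
    exact (not_lt.1 hn).trans_lt hj
  have hgm : AEMeasurable g (volume.restrict (Ioc 0 1)) :=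
    aemeasurable_of_tendsto_metrizable_ae Filter.atTop (fun n => (hφm n).aemeasurable) hae
  have hgg : g =ᵐ[volume.restrict (Ioc 0 1)] fun x => max (hgm.mk g x) 0 := by
    filter_upwards [hgm.ae_eq_mk, ae_restrict_mem measurableSet_Ioc] with x hx hx1
    rw [← hx, max_eq_left (hg x (Ioc_subset_Icc_self hx1))]
  refine ⟨fun x => max (hgm.mk g x) 0, hgm.measurable_mk.max measurable_const,
    fun x => le_max_right _ _, hgg, ?_⟩
  calc ∫⁻ x in Ioc 0 1, ENNReal.ofReal (max (hgm.mk g x) 0)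
      = ∫⁻ x in Ioc 0 1, Filter.liminf (fun n => ENNReal.ofReal (φ n x)) Filter.atTop := by
        refine lintegral_congr_ae ?_
        filter_upwards [hgg, hae] with x hx hx2
        rw [← hx, (ENNReal.tendsto_ofReal hx2).liminf_eq]
    _ ≤ Filter.liminf (fun n => ∫⁻ x in Ioc 0 1, ENNReal.ofReal (φ n x)) Filter.atTop :=
        lintegral_liminf_le fun n => (hφm n).ennreal_ofReal
    _ = ENNReal.ofReal I := by
        simp_rw [fun n => (hφi n hg).2]
        exact (ENNReal.tendsto_ofReal hsI).liminf_eq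

/-- The half-open cells of a tagged partition. -/
def TP.cell {n : ℕ} (P : TP n) (i : Fin n) : Set ℝ := Ioc (P.pt i.castSucc) (P.pt i.succ)

lemma TP.measurableSet_cell {n : ℕ} (P : TP n) (i : Fin n) : MeasurableSet (P.cell i) :=
  measurableSet_Ioc

lemma TP.len_nonneg {n : ℕ} (P : TP n) (i : Fin n) : 0 ≤ P.len i :=
  sub_nonneg.2 (P.mono (Fin.castSucc_lt_succ (i := i)).le)

lemma TP.volume_cell {n : ℕ} (P : TP n) (i : Fin n) :
    volume (P.cell i) = ENNReal.ofReal (P.len i) := Real.volume_Ioc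

lemma TP.pairwise_disjoint_cell {n : ℕ} (P : TP n) :
    Pairwise (Function.onFun Disjoint P.cell) := by
  have key : ∀ i j, i < j → Disjoint (P.cell i) (P.cell j) := fun i j hij =>
    Set.disjoint_left.2 fun x hx hx' => absurd (hx.2.trans (P.mono (Fin.le_def.2 (by
      simpa using hij)))) (not_le.2 hx'.1)
  intro i j hij
  rcases lt_or_gt_of_ne hij with h | h
  · exact key i j h
  · exact (key j i h).symm

lemma TP.pt_mem {n : ℕ} (P : TP n) (k : Fin (n + 1)) : P.pt k ∈ Icc (0:ℝ) 1 :=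
  ⟨P.first ▸ P.mono (Fin.zero_le k), P.last ▸ P.mono (Fin.le_last k)⟩

lemma TP.cell_subset {n : ℕ} (P : TP n) (i : Fin n) : P.cell i ⊆ Ioc 0 1 := fun _ hx =>
  ⟨(P.pt_mem _).1.trans_lt hx.1, hx.2.trans (P.pt_mem _).2⟩

lemma TP.iUnion_cell {n : ℕ} (P : TP n) : ⋃ i, P.cell i = Ioc 0 1 := by
  refine subset_antisymm (iUnion_subset P.cell_subset) fun x hx => ?_
  have key : ∀ k : Fin (n + 1), x ≤ P.pt k → x ∈ ⋃ i, P.cell i := by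
    intro k
    induction k using Fin.induction with
    | zero => exact fun h => absurd (P.first ▸ h) (not_le.2 hx.1)
    | succ i ih =>
      intro h
      by_cases h' : x ≤ P.pt i.castSucc
      · exact ih h'
      · exact mem_iUnion.2 ⟨i, not_le.1 h', h⟩
  exact key (Fin.last n) (P.last ▸ hx.2)

lemma TP.sum_lintegral_inter {n : ℕ} (P : TP n) {S : Set ℝ} (hS : MeasurableSet S)
    (F : ℝ → ℝ≥0∞) : ∑ i, ∫⁻ x in P.cell i ∩ S, F x = ∫⁻ x in Ioc 0 1 ∩ S, F x := by
  rw [← P.iUnion_cell, iUnion_inter, lintegral_iUnion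
    (fun i => (P.measurableSet_cell i).inter hS)
    (fun i j hij => (P.pairwise_disjoint_cell hij).mono inter_subset_left inter_subset_left),
    tsum_fintype]

lemma TP.sum_volume_inter {n : ℕ} (P : TP n) {S : Set ℝ} (hS : MeasurableSet S) :
    ∑ i, volume (P.cell i ∩ S) ≤ volume S := by
  have := P.sum_lintegral_inter hS 1
  simp only [Pi.one_apply, setLIntegral_one] at this
  rw [this]
  exact measure_mono inter_subset_right

/-- Bounding a sum over the cells in which the `i`-th term involves a set depending on the
label `q i`. -/
lemma TP.sum_label_le {n : ℕ} (P : TP n) (q : Fin n → ℕ) {S : ℕ → Set ℝ}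
    (hS : ∀ k, MeasurableSet (S k)) :
    ∑ i, ((q i : ℝ≥0∞) + 1) * volume (P.cell i ∩ S (q i)) ≤
      ∑' k : ℕ, ((k : ℝ≥0∞) + 1) * volume (S k) :=
  calc ∑ i, ((q i : ℝ≥0∞) + 1) * volume (P.cell i ∩ S (q i))
      ≤ ∑ i, ∑' k : ℕ, ((k : ℝ≥0∞) + 1) * volume (P.cell i ∩ S k) :=
        Finset.sum_le_sum fun i _ =>
          ENNReal.le_tsum (f := fun k : ℕ => ((k : ℝ≥0∞) + 1) * volume (P.cell i ∩ S k)) (q i)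
    _ = ∑' k : ℕ, ∑ i, ((k : ℝ≥0∞) + 1) * volume (P.cell i ∩ S k) :=
        (Summable.tsum_finsetSum fun _ _ => ENNReal.summable).symm
    _ ≤ _ := ENNReal.tsum_le_tsum fun k => by
        rw [← Finset.mul_sum]
        gcongr
        exact P.sum_volume_inter (hS k)

lemma exists_pos_tsum_le {r : ℝ} (hr : 0 < r) : ∃ θ : ℕ → ℝ, (∀ k, 0 < θ k) ∧
    ∑' k : ℕ, ((k : ℝ≥0∞) + 1) * ENNReal.ofReal (θ k) ≤ ENNReal.ofReal r := by
  obtain ⟨e, he, hs⟩ := ENNReal.exists_pos_sum_of_countable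
    (ENNReal.ofReal_pos.2 hr).ne' ℕ
  refine ⟨fun k => e k / ((k : ℝ) + 1), fun k => by have := he k; positivity, ?_⟩
  refine le_trans (ENNReal.tsum_le_tsum fun k => ?_) hs.le
  have h1 : ((k : ℝ≥0∞) + 1) = ENNReal.ofReal ((k : ℝ) + 1) := by
    rw [ENNReal.ofReal_add (by positivity) zero_le_one]
    simp
  rw [h1, ← ENNReal.ofReal_mul (by positivity), mul_div_cancel₀ _ (by positivity)]
  simp

/-- A set `S ⊆ [0, 1]` on which `δ` is positive is, up to small outer measure, contained in an open
set which is almost filled by the points of `S` at which `δ` is bounded away from zero. -/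
lemma exists_level {S : Set ℝ} (hS : S ⊆ Icc 0 1) {δ : ℝ → ℝ} (hδ : IsGauge δ) {θ : ℝ}
    (hθ : 0 < θ) : ∃ r > 0, ∃ G, IsOpen G ∧ S ⊆ G ∧
      volume (G \ toMeasurable volume {x ∈ S | r < δ x}) ≤ ENNReal.ofReal θ := by
  have hfin : ∀ T ⊆ S, volume T ≠ ⊤ := fun T hT =>
    ((measure_mono (hT.trans hS)).trans_lt (by simp)).ne
  have hθ2 : ENNReal.ofReal (θ / 2) ≠ 0 := (ENNReal.ofReal_pos.2 (by positivity)).ne'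
  obtain ⟨G, hSG, hG, hvG⟩ := S.exists_isOpen_lt_add (μ := volume) (hfin S subset_rfl) hθ2
  set A : ℕ → Set ℝ := fun m => {x ∈ S | 1 / ((m : ℝ) + 1) < δ x} with hA
  have hmono : Monotone A := fun m m' h x hx =>
    ⟨hx.1, (one_div_le_one_div_of_le (by positivity) (by exact_mod_cast Nat.succ_le_succ h)).trans_lt
      hx.2⟩
  have hU : ⋃ m, A m = S := by
    refine subset_antisymm (iUnion_subset fun m x hx => hx.1) fun x hx => ?_
    obtain ⟨m, hm⟩ := exists_nat_one_div_lt (hδ x (hS hx))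
    exact mem_iUnion.2 ⟨m, hx, hm⟩
  have hlim := tendsto_measure_iUnion_atTop (μ := volume) hmono
  rw [hU] at hlim
  have hex : ∃ m, volume S ≤ volume (A m) + ENNReal.ofReal (θ / 2) := by
    by_contra! hcon
    have h1 := le_of_tendsto' (hlim.add_const (ENNReal.ofReal (θ / 2))) fun m => (hcon m).le
    exact (ENNReal.lt_add_right (hfin S subset_rfl) hθ2).not_ge h1
  obtain ⟨m, hm⟩ := hex
  refine ⟨1 / ((m : ℝ) + 1), by positivity, G, hG, hSG, ?_⟩
  have hAS : A m ⊆ S := fun x hx => hx.1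
  have e := measure_inter_add_sdiff (μ := volume) G (measurableSet_toMeasurable volume (A m))
  rw [inter_comm, Measure.measure_toMeasurable_inter hG.measurableSet (hfin _ hAS),
    inter_eq_left.2 (hAS.trans hSG)] at e
  have h2 : volume (A m) + volume (G \ toMeasurable volume (A m)) ≤
      volume (A m) + ENNReal.ofReal θ := by
    rw [e]
    calc volume G ≤ volume S + ENNReal.ofReal (θ / 2) := hvG.le
      _ ≤ volume (A m) + ENNReal.ofReal (θ / 2) + ENNReal.ofReal (θ / 2) := by gcongr
      _ = volume (A m) + ENNReal.ofReal θ := by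
        rw [add_assoc, ← ENNReal.ofReal_add (by positivity) (by positivity), add_halves]
  exact (ENNReal.add_le_add_iff_left (hfin _ hAS)).1 h2

/-- For a uniformly Henstock integrable, pointwise bounded family of nonnegative functions there is
a gauge such that, for free partitions fine for it, the step functions approximate all members of
the family in the mean outside of a small set. -/
lemma exists_gauge_approx {A : Type*} {g : A → ℝ → ℝ} {I : A → ℝ} {q : ℝ → ℕ}
    (hg : ∀ a, ∀ t ∈ Icc (0:ℝ) 1, 0 ≤ g a t) (hq : ∀ a, ∀ t ∈ Icc (0:ℝ) 1, g a t ≤ q t)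
    (h : ∀ ε > 0, ∃ δ, IsGauge δ ∧ ∀ a, GaugeFor δ (g a) (I a) ε) {ε η : ℝ} (hε : 0 < ε)
    (hη : 0 < η) :
    ∃ Δ, IsGauge Δ ∧ ∃ W : ℕ → Set ℝ, (∀ k, MeasurableSet (W k)) ∧
      ∀ (n : ℕ) (P : TP n), P.IsFine Δ →
        ∑ i, ((q (P.tag i) : ℝ≥0∞) + 1) * volume (P.cell i \ W (q (P.tag i))) ≤
          ENNReal.ofReal η ∧
        ∀ (a : A) (g' : ℝ → ℝ), Measurable g' → (∀ x, 0 ≤ g' x) →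
          g a =ᵐ[volume.restrict (Ioc 0 1)] g' →
          ∑ i, ∫⁻ x in P.cell i ∩ W (q (P.tag i)), ENNReal.ofReal |g a (P.tag i) - g' x| ≤
            ENNReal.ofReal ε := by
  obtain ⟨θ, hθ, hθs⟩ := exists_pos_tsum_le (show 0 < ε / 2 by positivity)
  obtain ⟨ζ, hζ, hζs⟩ := exists_pos_tsum_le hη
  choose δ hδ hδg using fun k : ℕ => h (ε / 2 * θ k / 8) (by have := hθ k; positivity)
  set S : ℕ → Set ℝ := fun k => {x ∈ Icc (0:ℝ) 1 | q x = k} with hS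
  have hSI : ∀ k, S k ⊆ Icc 0 1 := fun k x hx => hx.1
  choose r hr G hG hSG hGv using fun k => exists_level (hSI k) (hδ k) (hζ k)
  have hball : ∀ t, ∃ ρ > 0, t ∈ Icc (0:ℝ) 1 → ball t ρ ⊆ G (q t) := by
    intro t
    by_cases ht : t ∈ Icc (0:ℝ) 1
    · obtain ⟨ρ, hρ, hb⟩ := Metric.isOpen_iff.1 (hG (q t)) t (hSG _ ⟨ht, rfl⟩)
      exact ⟨ρ, hρ, fun _ => hb⟩
    · exact ⟨1, one_pos, fun h => absurd h ht⟩
  choose ρ hρ hρG using hball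
  set B : ℕ → Set ℝ := fun k => {x ∈ S k | r k < δ k x} with hB
  have hBfin : ∀ k, volume (B k) ≠ ⊤ := fun k =>
    ((measure_mono (fun x hx => hSI k hx.1 : B k ⊆ Icc 0 1)).trans_lt (by simp)).ne
  refine ⟨fun t => min (min (δ (q t) t) (r (q t) / 2)) (ρ t), fun t ht =>
    lt_min (lt_min (hδ _ t ht) (by have := hr (q t); positivity)) (hρ t),
    fun k => toMeasurable volume (B k), fun k => measurableSet_toMeasurable _ _,
    fun n P hP => ⟨?_, fun a g' hg'm hg'0 hgg' => ?_⟩⟩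
  · refine le_trans ?_ ((P.sum_label_le (fun i => q (P.tag i)) fun k =>
      (hG k).measurableSet.diff (measurableSet_toMeasurable volume (B k))).trans
      (le_trans (ENNReal.tsum_le_tsum fun k => ?_) hζs))
    · refine Finset.sum_le_sum fun i _ => ?_
      gcongr
      rintro x ⟨hx, hxW⟩
      refine ⟨hx, hρG _ (P.tagMem i) ?_, hxW⟩
      have := hP i (Ioc_subset_Icc_self hx)
      rw [Real.ball_eq_Ioo]
      have h3 := min_le_right (min (δ (q (P.tag i)) (P.tag i)) (r (q (P.tag i)) / 2)) (ρ (P.tag i))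
      exact ⟨by linarith [this.1], by linarith [this.2]⟩
    · gcongr
      exact hGv k
  · have hc : 0 < ε / 2 := by positivity
    set Z : ℕ → Set ℝ := fun k => toMeasurable volume
      (⋃ p ∈ {p : ℝ × ℝ | BadPair (δ k) (g a) (ε / 2) p.1 p.2}, Icc p.1 p.2) with hZ
    have hZv : ∀ k, volume (Z k) ≤ ENNReal.ofReal (θ k) := fun k => by
      rw [hZ, measure_toMeasurable]
      refine ((hδg k a).volume_badPair_le hc).trans_eq (congrArg _ ?_)
      field_simp
    have hZm : ∀ k, MeasurableSet (Z k) := fun k => measurableSet_toMeasurable _ _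
    have hpt : ∀ i, ∀ᵐ x ∂(volume.restrict (P.cell i ∩ toMeasurable volume (B (q (P.tag i))))),
        ENNReal.ofReal |g a (P.tag i) - g' x| ≤ ENNReal.ofReal (ε / 2) +
          (Z (q (P.tag i))).indicator (fun _ => (q (P.tag i) : ℝ≥0∞) + 1) x := by
      intro i
      set t := P.tag i with ht
      have htI : t ∈ Icc (0:ℝ) 1 := P.tagMem i
      set F : ℝ → ℝ≥0∞ := fun x => ENNReal.ofReal |g a t - g' x|
      set H : ℝ → ℝ≥0∞ := fun x => ENNReal.ofReal (ε / 2) +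
          (Z (q t)).indicator (fun _ => (q t : ℝ≥0∞) + 1) x
      have hF : Measurable F := (measurable_const.sub hg'm).abs.ennreal_ofReal
      have hH : Measurable H := (measurable_const.indicator (hZm (q t))).const_add _
      have hms : MeasurableSet {x | ¬ F x ≤ H x} := (measurableSet_le hF hH).compl
      have hcm := P.measurableSet_cell i
      rw [ae_restrict_iff' (hcm.inter (measurableSet_toMeasurable _ _)), ae_iff]
      have e : {x | ¬(x ∈ P.cell i ∩ toMeasurable volume (B (q t)) → F x ≤ H x)} =
          toMeasurable volume (B (q t)) ∩ (P.cell i ∩ {x | ¬ F x ≤ H x}) := by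
        ext x
        simp only [Classical.not_imp, mem_ofPred_eq, mem_inter_iff]
        tauto
      rw [e, Measure.measure_toMeasurable_inter (hcm.inter hms) (hBfin _)]
      rw [Filter.EventuallyEq, ae_restrict_iff' measurableSet_Ioc, ae_iff] at hgg'
      refine measure_mono_null ?_ hgg'
      rintro x ⟨⟨⟨hxI, hxq⟩, hxr⟩, hxc, hx⟩
      simp only [Classical.not_imp, mem_ofPred_eq]
      refine ⟨P.cell_subset i hxc, fun hgx => hx ?_⟩
      simp only [F, H]
      rw [← hgx]
      have h0 := hg a t htI
      have h1 := hg a x hxI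
      have h2 := hq a t htI
      have h3 := hq a x hxI
      rw [hxq] at h3
      have habs : |g a t - g a x| ≤ q t := abs_le.2 ⟨by linarith, by linarith⟩
      by_cases hxZ : x ∈ Z (q t)
      · rw [indicator_of_mem hxZ]
        refine le_trans (ENNReal.ofReal_le_ofReal habs) ?_
        rw [ENNReal.ofReal_natCast]
        exact le_self_add.trans le_add_self
      · rw [indicator_of_notMem hxZ, add_zero]
        refine ENNReal.ofReal_le_ofReal (not_lt.1 fun hlt => hxZ (subset_toMeasurable _ _ ?_))
        have hab := hxc.1.le.trans hxc.2
        have hfa := hP i (left_mem_Icc.2 hab)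
        have hfb := hP i (right_mem_Icc.2 hab)
        simp only [← ht] at hfa hfb
        have m1 : min (min (δ (q t) t) (r (q t) / 2)) (ρ t) ≤ δ (q t) t :=
          (min_le_left _ _).trans (min_le_left _ _)
        have m2 : min (min (δ (q t) t) (r (q t) / 2)) (ρ t) ≤ r (q t) / 2 :=
          (min_le_left _ _).trans (min_le_right _ _)
        have hδt := hδ (q t) t htI
        have hrt := hr (q t)
        have ha := P.pt_mem i.castSucc
        have hb := P.pt_mem i.succ
        obtain ⟨hxa, hxb⟩ := hxc
        have l1 : min (P.pt i.castSucc) t ≤ x := (min_le_left _ _).trans hxa.le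
        have l2 : x ≤ max (P.pt i.succ) t := hxb.trans (le_max_left _ _)
        have l3 : t - δ (q t) t < min (P.pt i.castSucc) t :=
          lt_min (by linarith [hfa.1]) (by linarith)
        have l4 : max (P.pt i.succ) t < t + δ (q t) t :=
          max_lt (by linarith [hfb.2]) (by linarith)
        have l5 : x - δ (q t) x < min (P.pt i.castSucc) t :=
          lt_min (by linarith [hfa.1, hfb.2]) (by linarith [hfb.2])
        have l6 : max (P.pt i.succ) t < x + δ (q t) x :=
          max_lt (by linarith [hfa.1, hfb.2]) (by linarith [hfa.1])
        have ft : t ∈ Icc (min (P.pt i.castSucc) t) (max (P.pt i.succ) t) :=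
          ⟨min_le_right _ _, le_max_right _ _⟩
        rw [mem_iUnion₂]
        refine ⟨(min (P.pt i.castSucc) t, max (P.pt i.succ) t),
          ⟨le_min ha.1 htI.1, max_le hb.2 htI.2, ?_⟩, ⟨l1, l2⟩⟩
        rcases lt_abs.1 hlt with hlt | hlt
        · exact ⟨t, x, ⟨ft, l3, l4⟩, ⟨⟨l1, l2⟩, l5, l6⟩, hlt⟩
        · exact ⟨x, t, ⟨⟨l1, l2⟩, l5, l6⟩, ⟨ft, l3, l4⟩, by linarith⟩
    have hi : ∀ i, ∫⁻ x in P.cell i ∩ toMeasurable volume (B (q (P.tag i))),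
        ENNReal.ofReal |g a (P.tag i) - g' x| ≤ ENNReal.ofReal (ε / 2) * volume (P.cell i) +
          ((q (P.tag i) : ℝ≥0∞) + 1) * volume (P.cell i ∩ Z (q (P.tag i))) := by
      intro i
      refine (lintegral_mono_ae (hpt i)).trans
        ((lintegral_mono_set inter_subset_left).trans_eq ?_)
      rw [lintegral_add_left measurable_const, lintegral_const, Measure.restrict_apply_univ,
        lintegral_indicator_const (hZm _), Measure.restrict_apply (hZm _), inter_comm (Z _)]
    refine (Finset.sum_le_sum fun i _ => hi i).trans ?_
    rw [Finset.sum_add_distrib, ← Finset.mul_sum]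
    have hv : ∑ i, volume (P.cell i) ≤ 1 := by
      have := P.sum_volume_inter (measurableSet_Ioc (a := (0:ℝ)) (b := 1))
      simp only [inter_eq_left.2 (P.cell_subset _)] at this
      simpa using this
    calc _ ≤ ENNReal.ofReal (ε / 2) * 1 + ∑' k : ℕ, ((k : ℝ≥0∞) + 1) * volume (Z k) := by
          gcongr
          exact P.sum_label_le (fun i => q (P.tag i)) hZm
      _ ≤ ENNReal.ofReal (ε / 2) + ENNReal.ofReal (ε / 2) := by
          rw [mul_one]
          gcongr
          refine le_trans (ENNReal.tsum_le_tsum fun k => ?_) hθs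
          gcongr
          exact hZv k
      _ = ENNReal.ofReal ε := by
          rw [← ENNReal.ofReal_add hc.le hc.le, add_halves]

lemma IsGauge.inf {δ δ' : ℝ → ℝ} (h : IsGauge δ) (h' : IsGauge δ') :
    IsGauge fun t => min (δ t) (δ' t) := fun t ht => lt_min (h t ht) (h' t ht)

lemma TP.IsFine.mono {n : ℕ} {P : TP n} {δ δ' : ℝ → ℝ} (h : P.IsFine δ) (hle : ∀ t, δ t ≤ δ' t) :
    P.IsFine δ' := fun i => (h i).trans
  (Ioo_subset_Ioo (by linarith [hle (P.tag i)]) (by linarith [hle (P.tag i)]))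

/-- Cousin's lemma for partitions of `[0, 1]`. -/
lemma IsGauge.exists_perron {δ : ℝ → ℝ} (h : IsGauge δ) :
    ∃ (n : ℕ) (P : TP n), P.IsPerron ∧ P.IsFine δ := by
  obtain ⟨s, hs⟩ := HS.exists_of_le (g := 0) h zero_le_one
  obtain ⟨n, P, h1, h2, -⟩ := hs.exists_TP
  exact ⟨n, P, h1, h2⟩

lemma fSum_nonneg {n : ℕ} (P : TP n) {g : ℝ → ℝ} (hg : ∀ t ∈ Icc (0:ℝ) 1, 0 ≤ g t) :
    0 ≤ fSum P g :=
  Finset.sum_nonneg fun i _ => mul_nonneg (P.len_nonneg i) (hg _ (P.tagMem i))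

lemma ofReal_fSum {n : ℕ} (P : TP n) {g : ℝ → ℝ} (hg : ∀ t ∈ Icc (0:ℝ) 1, 0 ≤ g t) :
    ENNReal.ofReal (fSum P g) = ∑ i, ∫⁻ _ in P.cell i, ENNReal.ofReal (g (P.tag i)) := by
  simp only [fSum, smul_eq_mul]
  rw [ENNReal.ofReal_sum_of_nonneg fun i _ => mul_nonneg (P.len_nonneg i) (hg _ (P.tagMem i))]
  refine Finset.sum_congr rfl fun i _ => ?_
  rw [lintegral_const, Measure.restrict_apply_univ, P.volume_cell,
    ENNReal.ofReal_mul (P.len_nonneg i), mul_comm]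

/-- Upper estimate of a free Riemann sum by an integral off a measurable set `Y`. -/
lemma ofReal_fSum_le {n : ℕ} (P : TP n) {g g' : ℝ → ℝ} {q : ℝ → ℕ} {W : ℕ → Set ℝ} {ε η : ℝ≥0∞}
    (hg : ∀ t ∈ Icc (0:ℝ) 1, 0 ≤ g t) (hq : ∀ t ∈ Icc (0:ℝ) 1, g t ≤ q t)
    (hg' : Measurable g')
    (h1 : ∑ i, ((q (P.tag i) : ℝ≥0∞) + 1) * volume (P.cell i \ W (q (P.tag i))) ≤ η)
    (h2 : ∑ i, ∫⁻ x in P.cell i ∩ W (q (P.tag i)), ENNReal.ofReal |g (P.tag i) - g' x| ≤ ε)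
    {M : ℕ} (hM : ∀ i, q (P.tag i) ≤ M) {Y : Set ℝ} (hY : MeasurableSet Y) :
    ENNReal.ofReal (fSum P g) ≤
      (∫⁻ x in Ioc 0 1 ∩ Yᶜ, ENNReal.ofReal (g' x)) + ε + M * volume Y + η := by
  rw [ofReal_fSum P hg]
  have hi : ∀ i, ∫⁻ _ in P.cell i, ENNReal.ofReal (g (P.tag i)) ≤
      (∫⁻ x in P.cell i ∩ Yᶜ, ENNReal.ofReal (g' x)) +
      (∫⁻ x in P.cell i ∩ W (q (P.tag i)), ENNReal.ofReal |g (P.tag i) - g' x|) +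
      M * volume (P.cell i ∩ Y) +
      ((q (P.tag i) : ℝ≥0∞) + 1) * volume (P.cell i \ W (q (P.tag i))) := by
    intro i
    set t := P.tag i
    have hqt : ENNReal.ofReal (g t) ≤ q t :=
      (ENNReal.ofReal_le_ofReal (hq t (P.tagMem i))).trans_eq (ENNReal.ofReal_natCast _)
    have hsub : P.cell i ⊆ (P.cell i ∩ Yᶜ ∩ W (q t) ∪ P.cell i ∩ Y) ∪ P.cell i \ W (q t) := by
      intro x hx
      simp only [mem_union, mem_inter_iff, mem_compl_iff, mem_sdiff]
      tauto
    refine (lintegral_mono_set hsub).trans ((lintegral_union_le _ _ _).trans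
      (add_le_add ((lintegral_union_le _ _ _).trans (add_le_add ?_ ?_)) ?_))
    · calc ∫⁻ _ in P.cell i ∩ Yᶜ ∩ W (q t), ENNReal.ofReal (g t)
          ≤ ∫⁻ x in P.cell i ∩ Yᶜ ∩ W (q t),
              (ENNReal.ofReal (g' x) + ENNReal.ofReal |g t - g' x|) := by
            refine lintegral_mono fun x => ?_
            refine (ENNReal.ofReal_le_ofReal ?_).trans ENNReal.ofReal_add_le
            linarith [le_abs_self (g t - g' x)]
        _ = (∫⁻ x in P.cell i ∩ Yᶜ ∩ W (q t), ENNReal.ofReal (g' x)) +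
              ∫⁻ x in P.cell i ∩ Yᶜ ∩ W (q t), ENNReal.ofReal |g t - g' x| :=
            lintegral_add_left hg'.ennreal_ofReal _
        _ ≤ _ := add_le_add (lintegral_mono_set inter_subset_left)
            (lintegral_mono_set (inter_subset_inter_left _ inter_subset_left))
    · rw [lintegral_const, Measure.restrict_apply_univ]
      gcongr
      exact hqt.trans (by exact_mod_cast hM i)
    · rw [lintegral_const, Measure.restrict_apply_univ]
      gcongr
      exact hqt.trans le_self_add
  refine (Finset.sum_le_sum fun i _ => hi i).trans ?_
  rw [Finset.sum_add_distrib, Finset.sum_add_distrib, Finset.sum_add_distrib, ← Finset.mul_sum,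
    P.sum_lintegral_inter hY.compl]
  gcongr
  exact P.sum_volume_inter hY

/-- Lower estimate of a free Riemann sum. -/
lemma exists_lintegral_le_fSum {n : ℕ} (P : TP n) {g g' : ℝ → ℝ} {q : ℝ → ℕ} {W : ℕ → Set ℝ}
    {ε η : ℝ≥0∞} (hg : ∀ t ∈ Icc (0:ℝ) 1, 0 ≤ g t) (hW : ∀ k, MeasurableSet (W k))
    (h1 : ∑ i, ((q (P.tag i) : ℝ≥0∞) + 1) * volume (P.cell i \ W (q (P.tag i))) ≤ η)
    (h2 : ∑ i, ∫⁻ x in P.cell i ∩ W (q (P.tag i)), ENNReal.ofReal |g (P.tag i) - g' x| ≤ ε) :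
    ∃ Y, MeasurableSet Y ∧ volume Y ≤ η ∧
      ∫⁻ x in Ioc 0 1 ∩ Yᶜ, ENNReal.ofReal (g' x) ≤ ENNReal.ofReal (fSum P g) + ε := by
  have hYm : MeasurableSet (⋃ i, P.cell i \ W (q (P.tag i))) :=
    .iUnion fun i => (P.measurableSet_cell i).diff (hW _)
  refine ⟨_, hYm, ?_, ?_⟩
  · refine (measure_iUnion_fintype_le _ _).trans (le_trans (Finset.sum_le_sum fun i _ => ?_) h1)
    exact le_mul_of_one_le_left' le_add_self
  · rw [← P.sum_lintegral_inter hYm.compl, ofReal_fSum P hg]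
    refine le_trans (Finset.sum_le_sum fun i _ => ?_) ((Finset.sum_add_distrib).trans_le
      (add_le_add_right h2 _))
    have hsub : P.cell i ∩ (⋃ i, P.cell i \ W (q (P.tag i)))ᶜ ⊆ P.cell i ∩ W (q (P.tag i)) := by
      rintro x ⟨hx, hx'⟩
      refine ⟨hx, by_contra fun h => hx' (mem_iUnion.2 ⟨i, hx, h⟩)⟩
    calc _ ≤ ∫⁻ x in P.cell i ∩ W (q (P.tag i)), ENNReal.ofReal (g' x) := lintegral_mono_set hsub
      _ ≤ ∫⁻ x in P.cell i ∩ W (q (P.tag i)),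
            (ENNReal.ofReal (g (P.tag i)) + ENNReal.ofReal |g (P.tag i) - g' x|) := by
          refine lintegral_mono fun x => ?_
          refine (ENNReal.ofReal_le_ofReal ?_).trans ENNReal.ofReal_add_le
          linarith [neg_abs_le (g (P.tag i) - g' x)]
      _ = (∫⁻ _ in P.cell i ∩ W (q (P.tag i)), ENNReal.ofReal (g (P.tag i))) +
            ∫⁻ x in P.cell i ∩ W (q (P.tag i)), ENNReal.ofReal |g (P.tag i) - g' x| :=
          lintegral_add_left measurable_const _
      _ ≤ _ := add_le_add_left (lintegral_mono_set inter_subset_left) _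

/-- A uniformly Henstock integrable, pointwise bounded family of nonnegative functions is uniformly
McShane integrable. -/
theorem exists_gauge_of_uniform {A : Type*} {g : A → ℝ → ℝ} {I : A → ℝ}
    (hg : ∀ a, ∀ t ∈ Icc (0:ℝ) 1, 0 ≤ g a t) (hb : ∀ t ∈ Icc (0:ℝ) 1, ∃ M, ∀ a, g a t ≤ M)
    (h : ∀ ε > 0, ∃ δ, IsGauge δ ∧ ∀ a, GaugeFor δ (g a) (I a) ε) {ε : ℝ} (hε : 0 < ε) :
    ∃ Δ, IsGauge Δ ∧ ∀ (n : ℕ) (P : TP n), P.IsFine Δ → ∀ a, |fSum P (g a) - I a| ≤ ε := by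
  have hq : ∀ t, ∃ k : ℕ, t ∈ Icc (0:ℝ) 1 → ∀ a, g a t ≤ k := by
    intro t
    by_cases ht : t ∈ Icc (0:ℝ) 1
    · obtain ⟨M, hM⟩ := hb t ht
      obtain ⟨k, hk⟩ := exists_nat_ge M
      exact ⟨k, fun _ a => (hM a).trans hk⟩
    · exact ⟨0, fun h => absurd h ht⟩
  choose q hq using hq
  replace hq : ∀ a, ∀ t ∈ Icc (0:ℝ) 1, g a t ≤ q t := fun a t ht => hq t ht a
  choose g' hg'm hg'0 hgg' hg'I using fun a => exists_measurable_of_gaugeFor (I := I a) (hg a)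
    fun e he => (h e he).imp fun δ hδ => hδ.2 a
  set e := ε / 5 with he
  have he0 : 0 < e := by positivity
  obtain ⟨δ, hδ, hδg⟩ := h e he0
  obtain ⟨Δ₀, hΔ₀, W₀, -, hP₀⟩ := exists_gauge_approx hg hq h he0 he0
  obtain ⟨m, Q, hQ, hQf⟩ := (hδ.inf hΔ₀).exists_perron
  have hQδ : Q.IsFine δ := hQf.mono fun _ => min_le_left _ _
  obtain ⟨hQ1, hQ2⟩ := hP₀ m Q (hQf.mono fun _ => min_le_right _ _)
  set M := Finset.univ.sup fun i => q (Q.tag i)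
  have hM : ∀ i, q (Q.tag i) ≤ M := fun i =>
    Finset.le_sup (f := fun i => q (Q.tag i)) (Finset.mem_univ i)
  have hM1 : (0:ℝ) < M + 1 := by positivity
  obtain ⟨Δ, hΔ, W, hW, hP⟩ := exists_gauge_approx hg hq h he0
    (show 0 < e / (M + 1) by positivity)
  refine ⟨Δ, hΔ, fun n P hPf a => ?_⟩
  obtain ⟨hP1, hP2⟩ := hP n P hPf
  have hηe : e / (M + 1) ≤ e := div_le_self he0.le (by linarith [(Nat.cast_nonneg M : (0:ℝ) ≤ M)])
  specialize hP2 a (g' a) (hg'm a) (hg'0 a) (hgg' a)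
  specialize hQ2 a (g' a) (hg'm a) (hg'0 a) (hgg' a)
  have hIQ := abs_le.1 ((hδg a).2 m Q hQ hQδ)
  have hQ0 := fSum_nonneg Q (hg a)
  have hP0 := fSum_nonneg P (hg a)
  have hI0 : -e ≤ I a := by linarith
  have upper : fSum P (g a) ≤ max (I a) 0 + e + e := by
    have := ofReal_fSum_le P (hg a) (hq a) (hg'm a) hP1 hP2
      (M := Finset.univ.sup fun i => q (P.tag i))
      (fun i => Finset.le_sup (f := fun i => q (P.tag i)) (Finset.mem_univ i)) MeasurableSet.empty
    rw [compl_empty, inter_univ, measure_empty, mul_zero, add_zero] at this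
    have h2 := this.trans (add_le_add (add_le_add_left (hg'I a) _) (ENNReal.ofReal_le_ofReal hηe))
    rw [show ENNReal.ofReal (I a) = ENNReal.ofReal (max (I a) 0) by simp,
      ← ENNReal.ofReal_add (le_max_right _ _) he0.le,
      ← ENNReal.ofReal_add (add_nonneg (le_max_right _ _) he0.le) he0.le] at h2
    exact (ENNReal.ofReal_le_ofReal_iff (by positivity)).1 h2
  have lower : fSum Q (g a) ≤ fSum P (g a) + e + e + e + e := by
    obtain ⟨Y, hY, hYv, hYi⟩ := exists_lintegral_le_fSum P (hg a) hW hP1 hP2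
    have := ofReal_fSum_le Q (hg a) (hq a) (hg'm a) hQ1 hQ2 hM hY
    have hMY : (M : ℝ≥0∞) * volume Y ≤ ENNReal.ofReal e := by
      calc (M : ℝ≥0∞) * volume Y ≤ ENNReal.ofReal M * ENNReal.ofReal (e / (M + 1)) := by
            rw [ENNReal.ofReal_natCast]
            gcongr
        _ = ENNReal.ofReal (M * (e / (M + 1))) := (ENNReal.ofReal_mul (by positivity)).symm
        _ ≤ ENNReal.ofReal e := by
            refine ENNReal.ofReal_le_ofReal ?_
            rw [← mul_div_assoc, div_le_iff₀ hM1]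
            nlinarith
    have h2 := this.trans (add_le_add_left (add_le_add (add_le_add_left hYi _) hMY) _)
    rw [← ENNReal.ofReal_add (by positivity) (by positivity),
      ← ENNReal.ofReal_add (by positivity) (by positivity),
      ← ENNReal.ofReal_add (by positivity) (by positivity),
      ← ENNReal.ofReal_add (by positivity) (by positivity)] at h2
    exact (ENNReal.ofReal_le_ofReal_iff (by positivity)).1 h2
  have hmax : max (I a) 0 ≤ I a + e := max_le (by linarith) (by linarith)
  rw [abs_le]
  constructor <;> linarith

section CWK

variable {X : Type*} [NormedAddCommGroup X] [NormedSpace ℝ X]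

lemma continuous_comp_toWeakSpace_symm (x' : X →L[ℝ] ℝ) :
    Continuous fun w : WeakSpace ℝ X => x' ((toWeakSpace ℝ X).symm w) :=
  WeakBilin.eval_continuous (topDualPairing ℝ X).flip x'

lemma bddAbove_image {A : Set X} (hA : Bornology.IsBounded A) (x' : X →L[ℝ] ℝ) :
    BddAbove (x' '' A) := (hA.image x').bddAbove

lemma le_suppFn {A : Set X} (hA : Bornology.IsBounded A) (x' : X →L[ℝ] ℝ) {x : X} (hx : x ∈ A) :
    x' x ≤ suppFn x' A := le_csSup (bddAbove_image hA x') (mem_image_of_mem _ hx)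

lemma IsCWK.exists_max {K : Set X} (hK : IsCWK X K) (x' : X →L[ℝ] ℝ) :
    ∃ y ∈ K, ∀ x ∈ K, x' x ≤ x' y := by
  obtain ⟨_, ⟨y, hy, rfl⟩, hmax⟩ := hK.2.2.exists_isMaxOn (hK.1.image _)
    (continuous_comp_toWeakSpace_symm x').continuousOn
  refine ⟨y, hy, fun x hx => ?_⟩
  simpa using hmax (mem_image_of_mem _ hx)

lemma IsCWK.isBounded {K : Set X} (hK : IsCWK X K) : Bornology.IsBounded K := by
  obtain ⟨C, hC⟩ := banach_steinhaus
    (g := fun x : K => NormedSpace.inclusionInDoubleDual ℝ X x) (fun x' => by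
      obtain ⟨y, -, hy⟩ := hK.exists_max x'
      obtain ⟨z, -, hz⟩ := hK.exists_max (-x')
      refine ⟨max (x' y) ((-x') z), fun x => ?_⟩
      rw [NormedSpace.dual_def, Real.norm_eq_abs, abs_le']
      exact ⟨(hy x x.2).trans (le_max_left _ _), (hz x x.2).trans (le_max_right _ _)⟩)
  refine isBounded_iff_forall_norm_le.2 ⟨C, fun x hx => ?_⟩
  rw [← (NormedSpace.inclusionInDoubleDualLi ℝ (E := X)).norm_map x]
  exact hC ⟨x, hx⟩

lemma IsCWK.isClosed {K : Set X} (hK : IsCWK X K) : IsClosed K := by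
  have := hK.2.2.isClosed.preimage (toWeakSpaceCLM ℝ X).continuous
  rwa [show ⇑(toWeakSpaceCLM ℝ X) = toWeakSpace ℝ X from rfl,
    preimage_image_eq _ (toWeakSpace ℝ X).injective] at this

lemma IsCWK.subset {K L : Set X} (hK : IsCWK X K) (hL : L.Nonempty) (hLc : Convex ℝ L)
    (hLK : L ⊆ K) : IsCWK X (closure L) := by
  refine ⟨hL.closure, hLc.closure, ?_⟩
  rw [hLc.toWeakSpace_closure ℝ]
  exact hK.2.2.closure_of_subset (image_mono hLK)

lemma IsCWK.add_singleton {K : Set X} (hK : IsCWK X K) (w : X) : IsCWK X (K + {w}) := by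
  refine ⟨hK.1.add (singleton_nonempty w), hK.2.1.add (convex_singleton w), ?_⟩
  rw [image_add, image_singleton]
  exact hK.2.2.add isCompact_singleton

lemma IsCWK.sub_singleton {K : Set X} (hK : IsCWK X K) (w : X) : IsCWK X (K - {w}) := by
  simpa [sub_eq_add_neg] using hK.add_singleton (-w)

lemma suppFn_add {A B : Set X} (hA : A.Nonempty) (hB : B.Nonempty) (hA' : Bornology.IsBounded A)
    (hB' : Bornology.IsBounded B) (x' : X →L[ℝ] ℝ) :
    suppFn x' (A + B) = suppFn x' A + suppFn x' B := by
  rw [suppFn, image_add, csSup_add (hA.image _) (bddAbove_image hA' x') (hB.image _)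
    (bddAbove_image hB' x')]
  rfl

lemma suppFn_smul {c : ℝ} (hc : 0 ≤ c) (A : Set X) (x' : X →L[ℝ] ℝ) :
    suppFn x' (c • A) = c * suppFn x' A := by
  rw [suppFn, image_smul_set, Real.sSup_smul_of_nonneg hc, smul_eq_mul]
  rfl

lemma suppFn_singleton (w : X) (x' : X →L[ℝ] ℝ) : suppFn x' {w} = x' w := by
  simp [suppFn]

lemma suppFn_sum {ι : Type*} (s : Finset ι) {A : ι → Set X} (hA : ∀ i ∈ s, (A i).Nonempty)
    (hA' : ∀ i ∈ s, Bornology.IsBounded (A i)) (x' : X →L[ℝ] ℝ) :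
    (∑ i ∈ s, A i).Nonempty ∧ Bornology.IsBounded (∑ i ∈ s, A i) ∧
      suppFn x' (∑ i ∈ s, A i) = ∑ i ∈ s, suppFn x' (A i) := by
  classical
  induction s using Finset.induction_on with
  | empty => simpa [← Set.singleton_zero] using suppFn_singleton (0 : X) x'
  | insert i s hi ih =>
    obtain ⟨h1, h2, h3⟩ := ih (fun j hj => hA j (Finset.mem_insert_of_mem hj))
      (fun j hj => hA' j (Finset.mem_insert_of_mem hj))
    have h4 := hA i (Finset.mem_insert_self i s)
    have h5 := hA' i (Finset.mem_insert_self i s)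
    rw [Finset.sum_insert hi, Finset.sum_insert hi]
    exact ⟨h4.add h1, h5.add h2, by rw [suppFn_add h4 h1 h5 h2, h3]⟩

lemma mSum_aux {n : ℕ} (P : TP n) {Γ : ℝ → Set X}
    (hΓ : ∀ t ∈ Icc (0:ℝ) 1, IsCWK X (Γ t)) (x' : X →L[ℝ] ℝ) :
    (mSum P Γ).Nonempty ∧ Bornology.IsBounded (mSum P Γ) ∧
    suppFn x' (mSum P Γ) = ∑ i, suppFn x' (P.len i • Γ (P.tag i)) :=
  suppFn_sum _ (fun i _ => (hΓ _ (P.tagMem i)).1.smul_set)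
    (fun i _ => (hΓ _ (P.tagMem i)).isBounded.smul₀ _) x'

lemma nonempty_mSum {n : ℕ} (P : TP n) {Γ : ℝ → Set X}
    (hΓ : ∀ t ∈ Icc (0:ℝ) 1, IsCWK X (Γ t)) : (mSum P Γ).Nonempty := (mSum_aux P hΓ 0).1

lemma isBounded_mSum {n : ℕ} (P : TP n) {Γ : ℝ → Set X}
    (hΓ : ∀ t ∈ Icc (0:ℝ) 1, IsCWK X (Γ t)) : Bornology.IsBounded (mSum P Γ) :=
  (mSum_aux P hΓ 0).2.1

lemma convex_mSum {n : ℕ} (P : TP n) {Γ : ℝ → Set X}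
    (hΓ : ∀ t ∈ Icc (0:ℝ) 1, IsCWK X (Γ t)) : Convex ℝ (mSum P Γ) :=
  convex_sum _ fun i _ => (hΓ _ (P.tagMem i)).2.1.smul _

lemma suppFn_mSum {n : ℕ} (P : TP n) {Γ : ℝ → Set X}
    (hΓ : ∀ t ∈ Icc (0:ℝ) 1, IsCWK X (Γ t)) (x' : X →L[ℝ] ℝ) :
    suppFn x' (mSum P Γ) = fSum P fun t => suppFn x' (Γ t) := by
  rw [(mSum_aux P hΓ x').2.2]
  exact Finset.sum_congr rfl fun i _ => suppFn_smul (P.len_nonneg i) _ x'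

lemma fSum_mem_mSum {n : ℕ} (P : TP n) {Γ : ℝ → Set X} {f : ℝ → X} (hf : Selection Γ f) :
    fSum P f ∈ mSum P Γ :=
  Set.finsetSum_mem_finsetSum _ _ _ fun i _ => smul_mem_smul_set (hf _ (P.tagMem i))

lemma map_fSum {n : ℕ} (P : TP n) (f : ℝ → X) (x' : X →L[ℝ] ℝ) :
    x' (fSum P f) = fSum P fun t => x' (f t) := by
  simp [fSum]

lemma mSum_sub_singleton {n : ℕ} (P : TP n) (Γ : ℝ → Set X) (f : ℝ → X) :
    mSum P (fun t => Γ t - {f t}) = mSum P Γ - {fSum P f} := by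
  simp only [mSum, fSum, sub_eq_add_neg, smul_add, Finset.sum_add_distrib, neg_singleton,
    smul_set_singleton, smul_neg]
  congr 1
  rw [← Finset.sum_neg_distrib]
  exact (map_sum (Set.singletonAddMonoidHom (α := X)) _ _).symm

lemma suppFn_le_of_hausdorffDist_lt {A B : Set X} (hA : A.Nonempty) (hB : B.Nonempty)
    (hA' : Bornology.IsBounded A) (hB' : Bornology.IsBounded B) {r : ℝ}
    (h : hausdorffDist A B < r) (x' : X →L[ℝ] ℝ) :
    suppFn x' A ≤ suppFn x' B + ‖x'‖ * r := by
  refine csSup_le (hA.image _) ?_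
  rintro _ ⟨a, ha, rfl⟩
  obtain ⟨b, hb, hab⟩ := exists_dist_lt_of_hausdorffDist_lt ha h
    (hausdorffEDist_ne_top_of_nonempty_of_bounded hA hB hA' hB')
  have h1 : x' (a - b) ≤ ‖x'‖ * r := (le_abs_self _).trans ((x'.le_opNorm _).trans
    (mul_le_mul_of_nonneg_left (dist_eq_norm a b ▸ hab.le) (norm_nonneg _)))
  have h2 := le_suppFn hB' x' hb
  rw [map_sub] at h1
  linarith

lemma exists_dist_le_of_suppFn_le {A B : Set X} (hB : B.Nonempty) (hBc : Convex ℝ B)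
    (hA' : Bornology.IsBounded A) {r r' : ℝ} (hr : 0 ≤ r) (hrr' : r < r')
    (h : ∀ x' : X →L[ℝ] ℝ, ‖x'‖ ≤ 1 → suppFn x' A ≤ suppFn x' B + r) {a : X} (ha : a ∈ A) :
    ∃ b ∈ B, dist a b ≤ r' := by
  by_contra! hcon
  obtain ⟨f, u, hfu, huf⟩ := geometric_hahn_banach_open (convex_ball a r') isOpen_ball hBc
    (Set.disjoint_left.2 fun x hx hxB => (hcon x hxB).not_gt (mem_ball'.1 hx))
  have hs : 0 < u - f a := sub_pos.2 (hfu a (mem_ball_self (hr.trans_lt hrr')))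
  obtain ⟨ρ, h1, h2⟩ := exists_between hrr'
  have hρ : 0 < ρ := hr.trans_lt h1
  have hv : ∀ v : X, ‖v‖ = 1 → ρ * f v ≤ u - f a := fun v hv => by
    have := hfu (a + ρ • v) (by
      rwa [mem_ball, dist_self_add_left, norm_smul, hv, mul_one, Real.norm_of_nonneg hρ.le])
    simp only [map_add, map_smul, smul_eq_mul] at this
    linarith
  have hnorm : ‖f‖ ≤ (u - f a) / ρ := f.opNorm_le_of_unit_norm (by positivity) fun v hv1 => by
    rw [le_div_iff₀ hρ, Real.norm_eq_abs]
    have e1 := hv v hv1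
    have e2 := hv (-v) (by simpa using hv1)
    rw [map_neg] at e2
    rcases abs_cases (f v) with h | h <;> nlinarith
  set g : X →L[ℝ] ℝ := -(ρ / (u - f a)) • f with hg
  have hg1 : ‖g‖ ≤ 1 := by
    rw [hg, norm_smul, norm_neg, Real.norm_of_nonneg (by positivity)]
    calc ρ / (u - f a) * ‖f‖ ≤ ρ / (u - f a) * ((u - f a) / ρ) := by gcongr
      _ = 1 := by field_simp
  have e1 : suppFn g B ≤ g a - ρ := by
    refine csSup_le (hB.image _) ?_
    rintro _ ⟨b, hb, rfl⟩
    have := huf b hb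
    have e3 : ρ / (u - f a) * (u - f a) ≤ ρ / (u - f a) * (f b - f a) := by gcongr
    rw [div_mul_cancel₀ _ hs.ne'] at e3
    simp only [hg, smul_apply, smul_eq_mul]
    linarith
  have e2 := le_suppFn hA' g ha
  linarith [h g hg1]

lemma hausdorffDist_le_of_suppFn {A B : Set X} (hA : A.Nonempty) (hB : B.Nonempty)
    (hAc : Convex ℝ A) (hBc : Convex ℝ B) (hA' : Bornology.IsBounded A)
    (hB' : Bornology.IsBounded B) {r r' : ℝ} (hr : 0 ≤ r) (hrr' : r < r')
    (h : ∀ x' : X →L[ℝ] ℝ, ‖x'‖ ≤ 1 → |suppFn x' A - suppFn x' B| ≤ r) :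
    hausdorffDist A B ≤ r' := by
  refine hausdorffDist_le_of_mem_dist (hr.trans hrr'.le) (fun a ha => ?_) fun b hb => ?_
  · exact exists_dist_le_of_suppFn_le hB hBc hA' hr hrr'
      (fun x' hx' => by linarith [le_of_abs_le (h x' hx')]) ha
  · exact exists_dist_le_of_suppFn_le hA hAc hB' hr hrr'
      (fun x' hx' => by linarith [neg_le_of_abs_le (h x' hx')]) hb

end CWK

section StronglyExposed

variable {X : Type*} [NormedAddCommGroup X] [NormedSpace ℝ X]

/-- The functionals having a slice of diameter at most `ε` in `K`. -/
def SmallSlice (K : Set X) (ε : ℝ) : Set (X →L[ℝ] ℝ) :=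
  {z | ∃ α > 0, ∀ x ∈ K, ∀ y ∈ K, suppFn z K - α < z x → suppFn z K - α < z y → ‖x - y‖ ≤ ε}

lemma apply_le_apply_add {K : Set X} {R : ℝ} (hR : ∀ x ∈ K, ‖x‖ ≤ R) {z z' : X →L[ℝ] ℝ} {x : X}
    (hx : x ∈ K) : z x ≤ z' x + R * ‖z - z'‖ := by
  have h1 : (z - z') x ≤ R * ‖z - z'‖ := (le_abs_self _).trans (((z - z').le_opNorm x).trans
    ((mul_comm _ _).trans_le (mul_le_mul_of_nonneg_right (hR x hx) (norm_nonneg _))))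
  rw [sub_apply] at h1
  linarith

lemma suppFn_le_suppFn_add {K : Set X} (hK : K.Nonempty) {R : ℝ} (hR : ∀ x ∈ K, ‖x‖ ≤ R)
    (z z' : X →L[ℝ] ℝ) : suppFn z K ≤ suppFn z' K + R * ‖z - z'‖ := by
  refine csSup_le (hK.image _) ?_
  rintro _ ⟨x, hx, rfl⟩
  have := le_suppFn (isBounded_iff_forall_norm_le.2 ⟨R, hR⟩) z' hx
  linarith [apply_le_apply_add hR (z := z) (z' := z') hx]

lemma isOpen_smallSlice {K : Set X} (hK : IsCWK X K) (ε : ℝ) : IsOpen (SmallSlice K ε) := by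
  obtain ⟨R, hR0, hR⟩ := hK.isBounded.exists_pos_norm_le
  rw [Metric.isOpen_iff]
  rintro z ⟨α, hα, h⟩
  refine ⟨α / (4 * R), by positivity, fun z' hz' =>
    ⟨α / 2, by positivity, fun x hx y hy hx' hy' => ?_⟩⟩
  rw [mem_ball', dist_eq_norm, lt_div_iff₀ (by positivity)] at hz'
  have key : ∀ x ∈ K, suppFn z' K - α / 2 < z' x → suppFn z K - α < z x := fun x hx hx' => by
    have h1 := apply_le_apply_add hR (z := z') (z' := z) hx
    have h2 := suppFn_le_suppFn_add hK.1 hR z z'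
    rw [norm_sub_rev] at h1
    linarith
  exact h x hx y hy (key x hx hx') (key y hy hy')

lemma exists_countable_closed {E ι : Type*} [Countable ι] (F : ι → E → E) (x : E) :
    ∃ S : Set E, S.Countable ∧ x ∈ S ∧ ∀ z ∈ S, ∀ i, F i z ∈ S := by
  refine ⟨range fun l : List ι => l.foldl (fun z i => F i z) x, countable_range _, ⟨[], rfl⟩, ?_⟩
  rintro _ ⟨l, rfl⟩ i
  exact ⟨l ++ [i], by simp⟩

/-- A form of the Baire category theorem for the closure of a subset of a complete space. -/
lemma exists_ball_subset_closure {V ι : Type*} [MetricSpace V] [CompleteSpace V] [Countable ι]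
    {S U : Set V} (hU : IsOpen U) (hSU : (S ∩ U).Nonempty) (T : ι → Set V) (hT : ⋃ i, T i = univ) :
    ∃ x ∈ S ∩ U, ∃ i, ∃ ρ > 0, ∀ v ∈ S, dist v x < ρ → v ∈ closure (T i) := by
  have : CompleteSpace (closure S) := isClosed_closure.completeSpace_coe
  have hdense := dense_iUnion_interior_of_closed
    (f := fun i => ((↑) : closure S → V) ⁻¹' closure (T i))
    (fun i => isClosed_closure.preimage continuous_subtype_val) (by
      refine eq_univ_of_forall fun z => ?_
      obtain ⟨i, hi⟩ := mem_iUnion.1 (hT ▸ mem_univ (z : V))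
      exact mem_iUnion.2 ⟨i, subset_closure hi⟩)
  have hopen : IsOpen (((↑) : closure S → V) ⁻¹' U) := hU.preimage continuous_subtype_val
  obtain ⟨x₀, hx₀, hx₀U⟩ := hSU
  obtain ⟨z, hz, hz'⟩ := hdense.inter_open_nonempty _ hopen ⟨⟨x₀, subset_closure hx₀⟩, hx₀U⟩
  obtain ⟨i, hi⟩ := mem_iUnion.1 hz'
  obtain ⟨ρ, hρ, hρU⟩ := Metric.isOpen_iff.1 (hopen.inter isOpen_interior) z ⟨hz, hi⟩
  obtain ⟨x, hx, hzx⟩ := Metric.mem_closure_iff.1 z.2 ρ hρ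
  obtain ⟨hxU, hxi⟩ := hρU (show (⟨x, subset_closure hx⟩ : closure S) ∈ ball z ρ from
    mem_ball'.2 hzx)
  obtain ⟨ρ', hρ', hρ'U⟩ := Metric.isOpen_iff.1 isOpen_interior _ hxi
  refine ⟨x, ⟨hx, hxU⟩, i, ρ', hρ', fun v hv hvx => ?_⟩
  have := interior_subset (hρ'U (show (⟨v, subset_closure hv⟩ : closure S) ∈ ball _ ρ' from hvx))
  exact this

lemma dense_smallSlice {K : Set X} (hK : IsCWK X K) {ε : ℝ} (hε : 0 < ε) :
    Dense (SmallSlice K ε) := by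
  obtain ⟨R, hR0, hR⟩ := hK.isBounded.exists_pos_norm_le
  rw [Metric.dense_iff]
  intro x₀ r hr
  by_contra hcon
  have hex : ∀ (z : X →L[ℝ] ℝ) (j : ℕ), ∃ (p q : X) (w : X →L[ℝ] ℝ), p ∈ K ∧ q ∈ K ∧ ‖w‖ ≤ 1 ∧
      (z ∈ ball x₀ r → suppFn z K - 1 / ((j : ℝ) + 1) < z p ∧
        suppFn z K - 1 / ((j : ℝ) + 1) < z q ∧ ε < w p - w q) := by
    intro z j
    by_cases hz : z ∈ ball x₀ r
    · have h1 : z ∉ SmallSlice K ε := fun h => hcon ⟨z, hz, h⟩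
      simp only [SmallSlice, mem_ofPred_eq, not_exists, not_and] at h1
      have h2 := h1 (1 / ((j : ℝ) + 1)) (by positivity)
      push Not at h2
      obtain ⟨p, hp, q, hq, h3, h4, h5⟩ := h2
      obtain ⟨w, hw, hw'⟩ := exists_dual_vector'' ℝ (p - q)
      refine ⟨p, q, w, hp, hq, hw, fun _ => ⟨h3, h4, ?_⟩⟩
      rw [← map_sub, hw']
      exact h5
    · obtain ⟨y, hy⟩ := hK.1
      exact ⟨y, y, 0, hy, hy, by simp, fun h => absurd h hz⟩
  choose p q w hp hq hw hpq using hex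
  obtain ⟨S, hSc, hx₀S, hS⟩ := exists_countable_closed
    (fun (a : ℕ × ℚ) z => z + (a.2 : ℝ) • w z a.1) x₀
  replace hS : ∀ z ∈ S, ∀ (j : ℕ) (s : ℚ), z + (s : ℝ) • w z j ∈ S := fun z hz j s => hS z hz (j, s)
  obtain ⟨D, hDc, hDp, hDq, hDKsub⟩ : ∃ D : Set X, D.Countable ∧ (∀ z ∈ S, ∀ j, p z j ∈ D) ∧
      (∀ z ∈ S, ∀ j, q z j ∈ D) ∧ D ⊆ K := by
    refine ⟨(fun a : (X →L[ℝ] ℝ) × ℕ => p a.1 a.2) '' (S ×ˢ univ) ∪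
      (fun a : (X →L[ℝ] ℝ) × ℕ => q a.1 a.2) '' (S ×ˢ univ),
      ((hSc.prod countable_univ).image _).union ((hSc.prod countable_univ).image _),
      fun z hz j => Or.inl ⟨(z, j), ⟨hz, mem_univ _⟩, rfl⟩,
      fun z hz j => Or.inr ⟨(z, j), ⟨hz, mem_univ _⟩, rfl⟩, ?_⟩
    rintro _ (⟨a, -, rfl⟩ | ⟨a, -, rfl⟩)
    exacts [hp _ _, hq _ _]
  have hDK : convexHull ℝ D ⊆ K := convexHull_min hDKsub hK.2.1
  have hDne : D.Nonempty := ⟨_, hDp x₀ hx₀S 0⟩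
  have hK' := hK.subset hDne.convexHull (convex_convexHull ℝ D) hDK
  have hsub : D ⊆ closure (convexHull ℝ D) := (subset_convexHull ℝ D).trans subset_closure
  have hK'K : closure (convexHull ℝ D) ⊆ K := closure_minimal hDK hK.isClosed
  have hsep : TopologicalSpace.IsSeparable (closure (convexHull ℝ D)) :=
    (hDc.isSeparable.span (R := ℝ)).closure.mono
      (closure_mono (convexHull_min Submodule.subset_span (Submodule.span ℝ D).convex))
  obtain ⟨c, hc, hcd⟩ := hsep
  choose k hk hkmax using fun z : X →L[ℝ] ℝ => hK'.exists_max z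
  have : Countable c := hc.to_subtype
  set η := ε / 6 with hη
  have hη0 : 0 < η := by positivity
  obtain ⟨x, ⟨hxS, hx⟩, y, ρ', hρ', hxρ⟩ := exists_ball_subset_closure isOpen_ball
    ⟨x₀, hx₀S, mem_ball_self hr⟩ (fun y : c => {z | k z ∈ ball (y : X) η}) (by
      refine eq_univ_of_forall fun z => ?_
      obtain ⟨y, hy, hyz⟩ := Metric.mem_closure_iff.1 (hcd (hk z)) η hη0
      exact mem_iUnion.2 ⟨⟨y, hy⟩, hyz⟩)
  obtain ⟨s, hs0, hs⟩ := exists_rat_btwn hρ'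
  have hs0' : (0 : ℝ) < s := hs0
  obtain ⟨j, hj⟩ := exists_nat_one_div_lt (show 0 < s * η by positivity)
  obtain ⟨hjp, hjq, hjε⟩ := hpq x j hx
  have happrox : ∀ s' : ℚ, |(s' : ℝ)| = s →
      ∃ z, ‖z - (x + (s' : ℝ) • w x j)‖ < s * η / (2 * R) ∧
      k z ∈ ball (y : X) η := by
    intro s' hs'
    obtain ⟨z, hz, hz'⟩ := Metric.mem_closure_iff.1 (hxρ _ (hS x hxS j s') (by
      rw [dist_self_add_left, norm_smul, Real.norm_eq_abs, hs']
      exact (mul_le_of_le_one_right hs0'.le (hw _ _)).trans_lt hs))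
      (s * η / (2 * R)) (by positivity)
    refine ⟨z, ?_, hz⟩
    rwa [← dist_eq_norm, dist_comm]
  obtain ⟨z, hz, hzy⟩ := happrox s (abs_of_pos hs0')
  obtain ⟨z', hz', hzy'⟩ := happrox (-s) (by push_cast; rw [abs_neg, abs_of_pos hs0'])
  have hxmax : ∀ v ∈ K, x v ≤ suppFn x K := fun v hv => le_suppFn hK.isBounded _ hv
  have hest : ∀ (s' : ℚ) (z : X →L[ℝ] ℝ) (v : X), v ∈ D →
      suppFn x K - 1 / ((j : ℝ) + 1) < x v →
      ‖z - (x + (s' : ℝ) • w x j)‖ < s * η / (2 * R) →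
      s' * w x j v ≤ s' * w x j (k z) + 2 * (s * η) := by
    intro s' z v hv hv' hzs
    have e1 := hkmax z v (hsub hv)
    have e2 := apply_le_apply_add hR (z := z) (z' := x + (s' : ℝ) • w x j) (hK'K (hk z))
    have e3 := apply_le_apply_add hR (z := x + (s' : ℝ) • w x j) (z' := z) (hK'K (hsub hv))
    rw [norm_sub_rev] at e3
    have e4 := hxmax _ (hK'K (hk z))
    rw [lt_div_iff₀ (by positivity)] at hzs
    simp only [add_apply, smul_apply, smul_eq_mul] at e2 e3
    linarith
  have h1 := hest s z _ (hDp x hxS j) hjp hz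
  have h2 := hest (-s) z' _ (hDq x hxS j) hjq hz'
  push_cast at h2
  have h3 : w x j (k z - k z') ≤ 2 * η := by
    refine (le_abs_self _).trans (((w x j).le_opNorm _).trans ?_)
    refine (mul_le_of_le_one_left (norm_nonneg _) (hw _ _)).trans ?_
    rw [← dist_eq_norm]
    linarith [dist_triangle_right (k z) (k z') y, mem_ball.1 hzy, mem_ball.1 hzy']
  rw [map_sub] at h3
  have h4 : s * (w x j (p x j) - w x j (q x j)) ≤ s * (6 * η) := by nlinarith
  have h5 := le_of_mul_le_mul_left h4 hs0'
  linarith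

/-- A convex weakly compact set has a strongly exposing functional. -/
theorem IsCWK.exists_stronglyExposing {K : Set X} (hK : IsCWK X K) :
    ∃ z : X →L[ℝ] ℝ, ∀ ε > 0, z ∈ SmallSlice K ε := by
  obtain ⟨z, hz⟩ := (dense_iInter_of_isOpen_nat
    (fun n : ℕ => isOpen_smallSlice hK (1 / ((n : ℝ) + 1)))
    fun n => dense_smallSlice hK (by positivity)).nonempty
  refine ⟨z, fun ε hε => ?_⟩
  obtain ⟨n, hn⟩ := exists_nat_one_div_lt hε
  obtain ⟨α, hα, h⟩ := mem_iInter.1 hz n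
  exact ⟨α, hα, fun x hx y hy hx' hy' => (h x hx y hy hx' hy').trans hn.le⟩

end StronglyExposed

section Main

variable {X : Type*} [NormedAddCommGroup X] [NormedSpace ℝ X]

lemma suppFn_sub_singleton {A : Set X} (hA : A.Nonempty) (hA' : Bornology.IsBounded A) (w : X)
    (x' : X →L[ℝ] ℝ) : suppFn x' (A - {w}) = suppFn x' A - x' w := by
  rw [sub_eq_add_neg, neg_singleton, suppFn_add hA (singleton_nonempty _) hA'
    Bornology.isBounded_singleton, suppFn_singleton, map_neg, sub_eq_add_neg]

lemma abs_suppFn_sub_le {A B : Set X} (hA : A.Nonempty) (hB : B.Nonempty)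
    (hA' : Bornology.IsBounded A) (hB' : Bornology.IsBounded B) {r : ℝ}
    (h : hausdorffDist A B < r) {x' : X →L[ℝ] ℝ} (hx' : ‖x'‖ ≤ 1) :
    |suppFn x' A - suppFn x' B| ≤ r := by
  have hr : ‖x'‖ * r ≤ r := mul_le_of_le_one_left (hausdorffDist_nonneg.trans h.le) hx'
  have h1 := suppFn_le_of_hausdorffDist_lt hA hB hA' hB' h x'
  have h2 := suppFn_le_of_hausdorffDist_lt hB hA hB' hA' (hausdorffDist_comm.trans_lt h) x'
  rw [abs_le]
  constructor <;> linarith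

variable {Γ : ℝ → Set X}

lemma isCWK_sub (hΓ : ∀ t ∈ Icc (0:ℝ) 1, IsCWK X (Γ t)) (f : ℝ → X) :
    ∀ t ∈ Icc (0:ℝ) 1, IsCWK X (Γ t - {f t}) := fun t ht => (hΓ t ht).sub_singleton (f t)

lemma suppFn_mSum_sub (hΓ : ∀ t ∈ Icc (0:ℝ) 1, IsCWK X (Γ t)) (f : ℝ → X) {n : ℕ} (P : TP n)
    (x' : X →L[ℝ] ℝ) : suppFn x' (mSum P fun t => Γ t - {f t}) =
      suppFn x' (mSum P Γ) - x' (fSum P f) := by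
  rw [mSum_sub_singleton, suppFn_sub_singleton (nonempty_mSum P hΓ) (isBounded_mSum P hΓ)]

/-- A Henstock integrable multifunction has a Henstock integrable selection. -/
theorem HenstockIntegrable.exists_selection (hΓ : ∀ t ∈ Icc (0:ℝ) 1, IsCWK X (Γ t))
    (h : HenstockIntegrable Γ) : ∃ f, Selection Γ f ∧ FHenstockIntegrable f := by
  obtain ⟨I, hI, h⟩ := h
  obtain ⟨z, hz⟩ := hI.exists_stronglyExposing
  have hex : ∀ t, ∃ y, t ∈ Icc (0:ℝ) 1 → y ∈ Γ t ∧ ∀ x ∈ Γ t, z x ≤ z y := fun t => by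
    by_cases ht : t ∈ Icc (0:ℝ) 1
    · obtain ⟨y, hy⟩ := (hΓ t ht).exists_max z
      exact ⟨y, fun _ => hy⟩
    · exact ⟨0, fun h => absurd h ht⟩
  choose f hf using hex
  have hsel : Selection Γ f := fun t ht => (hf t ht).1
  obtain ⟨w, hw, hwmax⟩ := hI.exists_max z
  refine ⟨f, hsel, w, fun ε hε => ?_⟩
  obtain ⟨α, hα, hslice⟩ := hz (ε / 2) (by positivity)
  set d := min (ε / 2) (α / (2 * ‖z‖ + 1)) with hd
  have hd0 : 0 < d := lt_min (by positivity) (by positivity)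
  have hzd : 2 * ‖z‖ * d < α := by
    have : d * (2 * ‖z‖ + 1) ≤ α := (le_div_iff₀ (by positivity)).1 (min_le_right _ _)
    nlinarith
  obtain ⟨δ, hδ, hP⟩ := h d hd0
  refine ⟨δ, hδ, fun n P hPp hPf => ?_⟩
  have hdist := hP n P hPp hPf
  have hzf : suppFn z (mSum P Γ) ≤ z (fSum P f) := by
    rw [suppFn_mSum P hΓ, map_fSum]
    refine Finset.sum_le_sum fun i _ => mul_le_mul_of_nonneg_left ?_ (P.len_nonneg i)
    refine csSup_le ((hΓ _ (P.tagMem i)).1.image _) ?_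
    rintro _ ⟨x, hx, rfl⟩
    exact (hf _ (P.tagMem i)).2 x hx
  obtain ⟨y, hy, hys⟩ := exists_dist_lt_of_hausdorffDist_lt' (fSum_mem_mSum P hsel) hdist
    (hausdorffEDist_ne_top_of_nonempty_of_bounded hI.1 (nonempty_mSum P hΓ) hI.isBounded
      (isBounded_mSum P hΓ))
  have h1 := suppFn_le_of_hausdorffDist_lt hI.1 (nonempty_mSum P hΓ) hI.isBounded
    (isBounded_mSum P hΓ) hdist z
  have h2 : z (fSum P f - y) ≤ ‖z‖ * d := (le_abs_self _).trans ((z.le_opNorm _).trans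
    (mul_le_mul_of_nonneg_left (by rw [← dist_eq_norm, dist_comm]; exact hys.le) (norm_nonneg _)))
  rw [map_sub] at h2
  have h3 : suppFn z I ≤ z w := csSup_le (hI.1.image _) (by
    rintro _ ⟨x, hx, rfl⟩
    exact hwmax x hx)
  have h4 := hslice w hw y hy (by linarith) (by linarith)
  rw [← dist_eq_norm] at h4 ⊢
  linarith [dist_triangle w y (fSum P f), min_le_left (ε / 2) (α / (2 * ‖z‖ + 1))]

/-- The difference of a Henstock integrable multifunction and a Henstock integrable selection is
McShane integrable. -/
theorem HenstockIntegrable.mcShaneIntegrable_sub (hΓ : ∀ t ∈ Icc (0:ℝ) 1, IsCWK X (Γ t))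
    (h : HenstockIntegrable Γ) {f : ℝ → X} (hf : Selection Γ f) (hfi : FHenstockIntegrable f) :
    McShaneIntegrable fun t => Γ t - ({f t} : Set X) := by
  obtain ⟨I, hI, h⟩ := h
  obtain ⟨w, hw⟩ := hfi
  have hΔ := isCWK_sub hΓ f
  have hJ := hI.sub_singleton w
  have hsum : ∀ (n : ℕ) (P : TP n) (x' : X →L[ℝ] ℝ),
      (fSum P fun t => suppFn x' (Γ t - {f t})) = suppFn x' (mSum P Γ) - x' (fSum P f) :=
    fun n P x' => by rw [← suppFn_mSum_sub hΓ, suppFn_mSum P hΔ]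
  have key := fun ε (hε : (0:ℝ) < ε) => exists_gauge_of_uniform (A := {x' : X →L[ℝ] ℝ // ‖x'‖ ≤ 1})
    (g := fun x' t => suppFn x'.1 (Γ t - {f t})) (I := fun x' => suppFn x'.1 (I - {w}))
    (fun x' t ht => by
      have := le_suppFn (hΔ t ht).isBounded x'.1 (sub_mem_sub (hf t ht) (mem_singleton (f t)))
      rwa [sub_self, map_zero] at this)
    (fun t ht => by
      obtain ⟨R, hR0, hR⟩ := (hΔ t ht).isBounded.exists_pos_norm_le
      refine ⟨R, fun x' => csSup_le ((hΔ t ht).1.image _) ?_⟩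
      rintro _ ⟨x, hx, rfl⟩
      exact (le_abs_self _).trans ((x'.1.le_opNorm x).trans
        ((mul_le_of_le_one_left (norm_nonneg _) x'.2).trans (hR x hx))))
    (fun e he => by
      obtain ⟨δ₁, hδ₁, h₁⟩ := h (e / 2) (by positivity)
      obtain ⟨δ₂, hδ₂, h₂⟩ := hw (e / 2) (by positivity)
      refine ⟨_, hδ₁.inf hδ₂, fun x' => ⟨hδ₁.inf hδ₂, fun n P hP hPf => ?_⟩⟩
      have e1 := abs_le.1 (abs_suppFn_sub_le hI.1 (nonempty_mSum P hΓ) hI.isBounded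
        (isBounded_mSum P hΓ) (h₁ n P hP (hPf.mono fun _ => min_le_left _ _)) x'.2)
      have e2 : |x'.1 (w - fSum P f)| ≤ e / 2 := (x'.1.le_opNorm _).trans
        ((mul_le_of_le_one_left (norm_nonneg _) x'.2).trans
          (h₂ n P hP (hPf.mono fun _ => min_le_right _ _)).le)
      rw [map_sub, abs_le] at e2
      rw [hsum, suppFn_sub_singleton hI.1 hI.isBounded, abs_le]
      constructor <;> linarith) hε
  refine ⟨I - {w}, hJ, fun ε hε => ?_⟩
  obtain ⟨Δ, hΔg, hΔP⟩ := key (ε / 3) (by positivity)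
  refine ⟨Δ, hΔg, fun n P hP => ?_⟩
  refine (hausdorffDist_le_of_suppFn hJ.1 (nonempty_mSum P hΔ) hJ.2.1 (convex_mSum P hΔ)
    hJ.isBounded (isBounded_mSum P hΔ) (r := ε / 3) (r' := ε / 2) (by positivity) (by linarith)
    fun x' hx' => ?_).trans_lt (by linarith)
  rw [abs_sub_comm, suppFn_mSum P hΔ]
  exact hΔP n P hP ⟨x', hx'⟩

theorem HenstockIntegrable.of_sub (hΓ : ∀ t ∈ Icc (0:ℝ) 1, IsCWK X (Γ t)) {f : ℝ → X}
    (hfi : FHenstockIntegrable f) (h : McShaneIntegrable fun t => Γ t - ({f t} : Set X)) :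
    HenstockIntegrable Γ := by
  obtain ⟨J, hJ, h⟩ := h
  obtain ⟨w, hw⟩ := hfi
  have hΔ := isCWK_sub hΓ f
  have hI := hJ.add_singleton w
  refine ⟨J + {w}, hI, fun ε hε => ?_⟩
  obtain ⟨δ₁, hδ₁, h₁⟩ := h (ε / 6) (by positivity)
  obtain ⟨δ₂, hδ₂, h₂⟩ := hw (ε / 6) (by positivity)
  refine ⟨_, hδ₁.inf hδ₂, fun n P hP hPf => ?_⟩
  refine (hausdorffDist_le_of_suppFn hI.1 (nonempty_mSum P hΓ) hI.2.1 (convex_mSum P hΓ)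
    hI.isBounded (isBounded_mSum P hΓ) (r := ε / 3) (r' := ε / 2) (by positivity) (by linarith)
    fun x' hx' => ?_).trans_lt (by linarith)
  have e1 := abs_le.1 (abs_suppFn_sub_le hJ.1 (nonempty_mSum P hΔ) hJ.isBounded
    (isBounded_mSum P hΔ) (h₁ n P (hPf.mono fun _ => min_le_left _ _)) hx')
  have e2 : |x' (w - fSum P f)| ≤ ε / 6 := (x'.le_opNorm _).trans
    ((mul_le_of_le_one_left (norm_nonneg _) hx').trans
      (h₂ n P hP (hPf.mono fun _ => min_le_right _ _)).le)
  rw [map_sub, abs_le] at e2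
  rw [suppFn_mSum_sub hΓ] at e1
  rw [suppFn_add hJ.1 (singleton_nonempty w) hJ.isBounded Bornology.isBounded_singleton,
    suppFn_singleton, abs_le]
  constructor <;> linarith

end Main

/-- Theorem `t4` of the paper. For a scalarly Henstock–Kurzweil integrable
multifunction `Γ : [0,1] → cwk(X)` the following are equivalent: (i) `Γ` is Henstock
integrable; (ii) `Γ` has Henstock integrable selections and for every Henstock integrable
selection `f` the multifunction `Γ - f` is McShane integrable; (iii) there is a Henstock
integrable selection `f` of `Γ` with `Γ - f` McShane integrable. -/
theorem henstock_decomposition_tfae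
    {X : Type*} [NormedAddCommGroup X] [NormedSpace ℝ X] [CompleteSpace X]
    (Γ : ℝ → Set X) (hΓ : ∀ t ∈ Icc (0:ℝ) 1, IsCWK X (Γ t))
    (hsc : ∀ x' : X →L[ℝ] ℝ, HKIntegrable (fun t => suppFn x' (Γ t))) :
    List.TFAE [
      HenstockIntegrable Γ,
      (∃ f : ℝ → X, Selection Γ f ∧ FHenstockIntegrable f) ∧
        ∀ f : ℝ → X, Selection Γ f → FHenstockIntegrable f →
          McShaneIntegrable (fun t => Γ t - ({f t} : Set X)),
      ∃ f : ℝ → X, Selection Γ f ∧ FHenstockIntegrable f ∧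
        McShaneIntegrable (fun t => Γ t - ({f t} : Set X))
    ] := by
  tfae_have 1 → 2 := fun h => ⟨h.exists_selection hΓ, fun f hf hfi => h.mcShaneIntegrable_sub hΓ hf hfi⟩
  tfae_have 2 → 3 := fun ⟨⟨f, hf, hfi⟩, h⟩ => ⟨f, hf, hfi, h f hf hfi⟩
  tfae_have 3 → 1 := fun ⟨_, _, hfi, h⟩ => .of_sub hΓ hfi h
  tfae_finish

end GaugePaper
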